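/- Let 0.6 ≤ σ ≤ 2/3 and let T and T₀ be real numbers with T ≥ T₀ ≥ 3·10^12. Then N(σ,T) ≤ K(σ,T₀) · T^{4σ(1−σ)} · (log T)^{5−2σ}. -/

import Mathlib

open Real Complex Filter

/-- The constant `m₀ = √(1 + (2/3)·√(6/5))`. -/
noncomputable def m0 : ℝ := Real.sqrt (1 + (2/3) * Real.sqrt (6/5))

/-- The constant `C(σ, X₀)`. -/
noncomputable def Cconst (σ X₀ : ℝ) : ℝ :=
  σ / (2 * (2*σ - 1)^4) *
    ((2*σ - 1)^3 + 3*(2*σ - 1)^2 / Real.log X₀ + 6*(2*σ - 1) / (Real.log X₀)^2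
      + 6 / (Real.log X₀)^3)

/-- The constant `K_MV(σ, T) = 1/4 − ((2σ−1)/(4(2σ−2)))·(1 − T^{2σ−2})`. -/
noncomputable def KMV (σ T : ℝ) : ℝ :=
  1/4 - (2*σ - 1) / (4*(2*σ - 2)) * (1 - T ^ (2*σ - 2))

/-- The constant `K_MV^∞(σ) = 1/4 + (2σ−1)/(8(1−σ))`. -/
noncomputable def KMVinf (σ : ℝ) : ℝ := 1/4 + (2*σ - 1) / (8*(1 - σ))

/-- The constant `C₁(σ, T₀)`. -/
noncomputable def C1 (σ T₀ : ℝ) : ℝ :=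
  1.36 * (0.5 + 2*Real.pi*m0/T₀) * (2*σ - 1 + Real.log (Real.log T₀) / Real.log T₀)^3
      * Cconst σ (T₀ ^ (2*σ - 1))
    + 2*Real.pi*m0 * (KMVinf σ / Real.log T₀)
      * (2*σ + Real.log (Real.log T₀) / Real.log T₀)^2

/-- The constant `C₂(σ, T₀)`. -/
noncomputable def C2 (σ T₀ : ℝ) : ℝ :=
  2 * C1 σ T₀ + 166.34/(2*σ - 1) * (1 - (2:ℝ)^(1 - 2*σ)) / (T₀ * (Real.log T₀)^3)

/-- The constant `C₃(σ, T₀)`. -/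
noncomputable def C3 (σ T₀ : ℝ) : ℝ :=
  C2 σ T₀ / (1 - (0.5:ℝ)^(4*σ*(1 - σ)))

/-- The constant `K(σ, T₀)`. -/
noncomputable def Kconst (σ T₀ : ℝ) : ℝ :=
  C3 σ T₀ / (2*Real.pi) + 0.004*(1.25 - σ + 1/Real.log T₀)
    + 0.05/(4*Real.pi*(Real.log T₀)^2)

/-- `d n` is the number of positive divisors of `n`. -/
def numDiv (n : ℕ) : ℕ := n.divisors.card

/-- The mollifier `M_X(s) = Σ_{n ≤ X} μ(n) n^{−s}`. -/
noncomputable def MX (X : ℝ) (s : ℂ) : ℂ :=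
  ∑ n ∈ Finset.Icc 1 ⌊X⌋₊, (ArithmeticFunction.moebius n : ℂ) * (n : ℂ) ^ (-s)

/-- `f_X(s) = ζ(s)·M_X(s) − 1`. -/
noncomputable def fX (X : ℝ) (s : ℂ) : ℂ := riemannZeta s * MX X s - 1

/-- `h_X(s) = 1 − f_X(s)²`. -/
noncomputable def hX (X : ℝ) (s : ℂ) : ℂ := 1 - (fX X s)^2

/-- `N(σ, T)`: the number of nontrivial zeros `ρ` of the Riemann zeta function with
`Re ρ > σ` and `0 < Im ρ ≤ T`. -/
noncomputable def Nzeros (σ T : ℝ) : ℕ :=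
  Nat.card {ρ : ℂ | riemannZeta ρ = 0 ∧ σ < ρ.re ∧ 0 < ρ.im ∧ ρ.im ≤ T}

open MeasureTheory FourierTransform in
theorem fourier_plancherel_le {g : ℝ → ℂ} (hg : Integrable g) :
    ∫⁻ ξ, ‖𝓕 g ξ‖ₑ ^ 2 ≤ ∫⁻ u, ‖g u‖ₑ ^ 2 := by
  by_cases hfin : ∫⁻ u, ‖g u‖ₑ ^ 2 = ⊤
  · rw [hfin]; exact le_top
  have hn : ∀ f : ℝ → ℂ, eLpNorm f 2 volume ^ 2 = ∫⁻ u, ‖f u‖ₑ ^ 2 := by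
    intro f
    have := eLpNorm_nnreal_pow_eq_lintegral (f := f) (μ := volume) (p := 2) (by norm_num)
    simpa using this
  have hg2 : MemLp g 2 := by
    refine ⟨hg.1, ?_⟩
    have := hn g
    rw [lt_top_iff_ne_top]
    intro h
    rw [h] at this
    simp at this
    exact hfin this.symm
  have hcont : Continuous (𝓕 g) :=
    VectorFourier.fourierIntegral_continuous Real.continuous_fourierChar
      (by exact continuous_inner) hg
  set G : Lp ℂ 2 (volume : Measure ℝ) := hg2.toLp g with hG
  have hae : ∀ᵐ ξ, 𝓕 g ξ = (𝓕 G : Lp ℂ 2 (volume : Measure ℝ)) ξ := by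
    apply ae_eq_of_integral_contDiff_smul_eq hcont.locallyIntegrable
      ((Lp.memLp (𝓕 G)).locallyIntegrable (by norm_num))
    intro φ hφ hφs
    have hφ1 : ContDiff ℝ (⊤ : ℕ∞) (fun x => (φ x : ℂ)) := by
      exact Complex.ofRealCLM.contDiff.comp hφ
    have hφ2 : HasCompactSupport (fun x => (φ x : ℂ)) := hφs.comp_left (g := fun x : ℝ => (x : ℂ)) rfl
    let Φ : SchwartzMap ℝ ℂ := hφ2.toSchwartzMap hφ1
    have h1 := congrArg (fun T => T Φ) (Lp.fourier_toTemperedDistribution_eq G)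
    simp only [TemperedDistribution.fourier_apply, Lp.toTemperedDistribution_apply] at h1
    have h2 : ∫ x, (𝓕 Φ) x • G x = ∫ x, (𝓕 Φ) x • g x := by
      apply integral_congr_ae
      filter_upwards [hg2.coeFn_toLp] with x hx
      rw [hG, hx]
    have h3 := VectorFourier.integral_fourierIntegral_smul_eq_flip (L := innerₗ ℝ)
      Real.continuous_fourierChar continuous_inner (Φ.integrable (μ := volume)) hg
    have h4 : ∫ x, (𝓕 Φ) x • g x = ∫ x, Φ x • 𝓕 g x := by
      rw [SchwartzMap.fourier_coe]
      simpa using! h3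
    have hΦ : ∀ x, Φ x = (φ x : ℂ) := fun x => rfl
    calc ∫ x, φ x • 𝓕 g x = ∫ x, Φ x • 𝓕 g x := by simp [hΦ]
      _ = ∫ x, Φ x • (𝓕 G : Lp ℂ 2 (volume : Measure ℝ)) x := by rw [← h4, ← h2, h1]
      _ = _ := by simp [hΦ]
  calc ∫⁻ ξ, ‖𝓕 g ξ‖ₑ ^ 2 = ∫⁻ ξ, ‖(𝓕 G : Lp ℂ 2 (volume : Measure ℝ)) ξ‖ₑ ^ 2 := by
        apply lintegral_congr_ae
        filter_upwards [hae] with x hx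
        rw [hx]
    _ = ∫⁻ u, ‖G u‖ₑ ^ 2 := by
        rw [← hn, ← hn, ← Lp.enorm_def, ← Lp.enorm_def]
        congr 1
        rw [← ofReal_norm, ← ofReal_norm, Lp.norm_fourier_eq]
    _ ≤ ∫⁻ u, ‖g u‖ₑ ^ 2 := by
        apply le_of_eq
        apply lintegral_congr_ae
        filter_upwards [hg2.coeFn_toLp] with x hx
        rw [hG, hx]

open MeasureTheory FourierTransform in
theorem plancherel_le {g : ℝ → ℂ} (hg : Integrable g) :
    ∫⁻ t : ℝ, ‖∫ u : ℝ, g u * cexp (-(u * t * I))‖ₑ ^ 2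
      ≤ ENNReal.ofReal (2 * π) * ∫⁻ u, ‖g u‖ₑ ^ 2 := by
  have h1 : ∀ ξ : ℝ, ∫ u : ℝ, g u * cexp (-(u * (2 * π * ξ : ℝ) * I)) = 𝓕 g ξ := by
    intro ξ
    rw [Real.fourier_real_eq_integral_exp_smul]
    apply integral_congr_ae
    refine Eventually.of_forall fun u => ?_
    simp only [smul_eq_mul]
    rw [mul_comm]
    congr 2
    push_cast
    ring
  have h2 := fourier_plancherel_le hg
  have hpi : (0:ℝ) < 2 * π := by positivity
  have key : ∀ F : ℝ → ENNReal,
      ∫⁻ t, F t = ENNReal.ofReal (2 * π) * ∫⁻ ξ, F (2 * π * ξ) := by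
    intro F
    conv_lhs => rw [← Real.smul_map_volume_mul_left hpi.ne']
    rw [lintegral_smul_measure, abs_of_pos hpi, smul_eq_mul,
      (measurableEmbedding_mulLeft₀ hpi.ne').lintegral_map]
  rw [key]
  simp only [h1]
  gcongr

/-- The Fourier-Laplace transform of an interval of length `h`. -/
noncomputable def expKernel (h : ℝ) (s : ℂ) : ℂ := (cexp (h * s) - 1) / s

/-- The function `u ↦ a n * exp (-x u)` restricted to `log n - h ≤ u < log n`. -/
noncomputable def dirichletBlock (a : ℕ → ℂ) (h x : ℝ) (n : ℕ) (u : ℝ) : ℂ :=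
  (Set.Ico (Real.log n - h) (Real.log n)).indicator (fun u : ℝ => a n * cexp (-(x * u))) u

open MeasureTheory in
theorem integrable_tsum_of_finite_support {F : ℕ → ℝ → ℂ} (hF : ∀ n, Measurable (F n))
    (hfin : ∀ u, (Function.support fun n => F n u).Finite)
    (hsum : ∑' n, ∫⁻ u, ‖F n u‖ₑ ≠ ⊤) : Integrable (fun u => ∑' n, F n u) := by
  have hmeas : Measurable (fun u => ∑' n, F n u) := by
    apply measurable_of_tendsto_metrizable (f := fun N u => ∑ n ∈ Finset.range N, F n u)
    · intro N
      exact Finset.measurable_fun_sum _ fun n _ => hF n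
    · rw [tendsto_pi_nhds]
      intro u
      exact (summable_of_hasFiniteSupport (hfin u)).hasSum.tendsto_sum_nat
  refine ⟨hmeas.aestronglyMeasurable, ?_⟩
  rw [hasFiniteIntegral_iff_enorm]
  calc ∫⁻ u, ‖∑' n, F n u‖ₑ ≤ ∫⁻ u, ∑' n, ‖F n u‖ₑ :=
        lintegral_mono fun u => enorm_tsum_le_tsum_enorm
    _ = ∑' n, ∫⁻ u, ‖F n u‖ₑ := lintegral_tsum fun n => (hF n).enorm.aemeasurable
    _ < ⊤ := hsum.lt_top

theorem dirichletBlock_measurable (a : ℕ → ℂ) (h x : ℝ) (n : ℕ) :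
    Measurable (dirichletBlock a h x n) := by
  unfold dirichletBlock
  apply Measurable.indicator _ measurableSet_Ico
  fun_prop

theorem norm_dirichletBlock_le (a : ℕ → ℂ) {h x : ℝ} (hx : 0 < x) {n : ℕ} (hn : n ≠ 0) (u : ℝ) :
    ‖dirichletBlock a h x n u‖ ≤ (Set.Ico (Real.log n - h) (Real.log n)).indicator
      (fun _ => ‖a n‖ * rexp (x * h) / n ^ x) u := by
  unfold dirichletBlock
  rw [norm_indicator_eq_indicator_norm]
  apply Set.indicator_le_indicator'
  intro hu
  have hn' : (0:ℝ) < n := by positivity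
  rw [norm_mul, Complex.norm_exp, mul_div_assoc]
  gcongr
  rw [Real.rpow_def_of_pos hn', ← Real.exp_sub]
  apply Real.exp_le_exp.2
  have : (-((x:ℂ) * u)).re = -(x * u) := by simp
  rw [this]
  have := hu.1
  nlinarith

theorem dirichletBlock_ne_zero {a : ℕ → ℂ} {h x : ℝ} {n : ℕ} (hn : n ≠ 0) {u : ℝ}
    (hb : dirichletBlock a h x n u ≠ 0) : n ∈ Finset.Ioc ⌊rexp u⌋₊ ⌊rexp (u + h)⌋₊ := by
  have hn' : (0:ℝ) < n := by positivity
  have hu := Set.mem_of_indicator_ne_zero hb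
  rw [Finset.mem_Ioc, Nat.floor_lt (Real.exp_pos _).le, Nat.le_floor_iff (Real.exp_pos _).le]
  constructor
  · exact (Real.lt_log_iff_exp_lt hn').1 hu.2
  · exact (Real.log_le_iff_le_exp hn').1 (by linarith [hu.1])

theorem card_Ioc_floor_exp_le {u h : ℝ} (hh : 0 ≤ h) :
    ((Finset.Ioc ⌊rexp u⌋₊ ⌊rexp (u + h)⌋₊).card : ℝ) ≤ rexp u * (rexp h - 1) + 1 := by
  have h1 : ⌊rexp u⌋₊ ≤ ⌊rexp (u + h)⌋₊ := Nat.floor_mono (Real.exp_le_exp.2 (by linarith))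
  rw [Nat.card_Ioc, Nat.cast_sub h1]
  have h2 := Nat.floor_le (Real.exp_pos (u + h)).le
  have h3 := Nat.lt_floor_add_one (rexp u)
  rw [Real.exp_add] at *
  linarith

open MeasureTheory in
theorem integral_dirichletBlock (a : ℕ → ℂ) {h x : ℝ} (hh : 0 ≤ h) (hx : 0 < x) {n : ℕ} (hn : n ≠ 0)
    (t : ℝ) :
    ∫ u : ℝ, dirichletBlock a h x n u * cexp (-(u * t * I)) =
      LSeries.term a (x + t * I) n * expKernel h (x + t * I) := by
  have hn' : (0:ℝ) < n := by positivity
  have hs : (x + t * I : ℂ) ≠ 0 := by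
    intro h0
    have := congrArg Complex.re h0
    simp at this
    exact hx.ne' this
  have h1 : ∀ u : ℝ, dirichletBlock a h x n u * cexp (-(u * t * I)) =
      (Set.Ico (Real.log n - h) (Real.log n)).indicator
        (fun u : ℝ => a n * cexp (-(x + t * I) * u)) u := by
    intro u
    unfold dirichletBlock
    by_cases hu : u ∈ Set.Ico (Real.log n - h) (Real.log n)
    · simp only [hu, Set.indicator_of_mem]
      rw [mul_assoc, ← Complex.exp_add]
      congr 2
      ring
    · simp [hu]
  simp_rw [h1]
  rw [integral_indicator measurableSet_Ico, integral_Ico_eq_integral_Ioc,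
    ← intervalIntegral.integral_of_le (by linarith), intervalIntegral.integral_const_mul,
    integral_exp_mul_complex (neg_ne_zero.2 hs), LSeries.term_of_ne_zero hn,
    Complex.cpow_def_of_ne_zero (by exact_mod_cast hn), expKernel, div_eq_mul_inv (a n),
    ← Complex.exp_neg, Complex.natCast_log]
  push_cast
  rw [show -(x + t * I : ℂ) * (Complex.log n - (h:ℂ)) =
    -(Complex.log n * (x + t * I)) + h * (x + t * I) by ring, Complex.exp_add,
    show -(x + t * I : ℂ) * Complex.log n = -(Complex.log n * (x + t * I)) by ring]
  field_simp
  ring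

theorem dirichletBlock_support_subset {a : ℕ → ℂ} (ha0 : a 0 = 0) (h x u : ℝ) :
    (Function.support fun n => dirichletBlock a h x n u) ⊆
      (Finset.Ioc ⌊rexp u⌋₊ ⌊rexp (u + h)⌋₊ : Set ℕ) := by
  intro n hn
  have hn0 : n ≠ 0 := by
    rintro rfl
    simp [dirichletBlock, ha0] at hn
  exact dirichletBlock_ne_zero hn0 hn

open MeasureTheory in
theorem integrable_tsum_dirichletBlock {a : ℕ → ℂ} (ha0 : a 0 = 0) {x h : ℝ} (hx : 0 < x)
    (hh : 0 < h) (ha : LSeriesSummable a x) :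
    Integrable (fun u => ∑' n, dirichletBlock a h x n u) ∧
    ∀ t : ℝ, ∫ u : ℝ, (∑' n, dirichletBlock a h x n u) * cexp (-(u * t * I)) =
      LSeries a (x + t * I) * expKernel h (x + t * I) := by
  set F := dirichletBlock a h x with hFdef
  have hF0 : F 0 = 0 := by
    ext u; simp [hFdef, dirichletBlock, ha0]
  have hmeas : ∀ n, Measurable (F n) := dirichletBlock_measurable a h x
  set M : ℕ → ℝ := fun n => ‖a n‖ * rexp (x * h) / n ^ x with hM
  have hM0 : ∀ n, 0 ≤ M n := fun n => by positivity
  have hMF : ∀ n u, ‖F n u‖ ≤ (Set.Ico (Real.log n - h) (Real.log n)).indicator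
      (fun _ => M n) u := by
    intro n u
    rcases eq_or_ne n 0 with rfl | hn
    · rw [hF0]
      simp only [Pi.zero_apply, norm_zero]
      exact Set.indicator_nonneg (fun _ _ => hM0 0) _
    · exact norm_dirichletBlock_le a hx hn u
  have hMsum : Summable M := by
    have := (ha.norm).mul_right (rexp (x * h))
    refine this.congr fun n => ?_
    rw [LSeries.norm_term_eq]
    split_ifs with hn
    · simp [hM, hn, ha0]
    · simp [hM]; ring
  have hl1 : ∀ n, ∫⁻ u, ‖F n u‖ₑ ≤ ENNReal.ofReal (M n * h) := by
    intro n
    calc ∫⁻ u, ‖F n u‖ₑ ≤ ∫⁻ u, (Set.Ico (Real.log n - h) (Real.log n)).indicator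
          (fun _ => ENNReal.ofReal (M n)) u := by
          apply lintegral_mono
          intro u
          have := hMF n u
          by_cases hu : u ∈ Set.Ico (Real.log n - h) (Real.log n)
          · simp only [hu, Set.indicator_of_mem] at this ⊢
            rw [← ofReal_norm]
            exact ENNReal.ofReal_le_ofReal this
          · simp only [hu, not_false_eq_true, Set.indicator_of_notMem] at this ⊢
            rw [← ofReal_norm]
            simpa using this
      _ = _ := by
          rw [lintegral_indicator measurableSet_Ico, lintegral_const, Measure.restrict_apply_univ,
            Real.volume_Ico, ENNReal.ofReal_mul (hM0 n)]
          congr 2; ring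
  have hsum1 : ∑' n, ∫⁻ u, ‖F n u‖ₑ ≠ ⊤ := by
    refine ne_top_of_le_ne_top ?_ (ENNReal.tsum_le_tsum hl1)
    exact (hMsum.mul_right h).tsum_ofReal_ne_top
  have hInt : Integrable (fun u => ∑' n, F n u) :=
    integrable_tsum_of_finite_support hmeas
      (fun u => (Finset.finite_toSet _).subset (dirichletBlock_support_subset ha0 h x u)) hsum1
  have htrans : ∀ t : ℝ, ∫ u : ℝ, (∑' n, F n u) * cexp (-(u * t * I)) =
      LSeries a (x + t * I) * expKernel h (x + t * I) := by
    intro t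
    have hexp : ∀ u : ℝ, ‖cexp (-(u * t * I))‖ₑ = 1 := by
      intro u
      rw [← ofReal_norm, show -(u * t * I : ℂ) = ((-(u * t) : ℝ) : ℂ) * I by push_cast; ring,
        Complex.norm_exp_ofReal_mul_I, ENNReal.ofReal_one]
    simp_rw [← tsum_mul_right]
    rw [integral_tsum]
    · rw [LSeries, ← tsum_mul_right]
      congr 1
      ext n
      rcases eq_or_ne n 0 with rfl | hn
      · simp [hF0]
      · exact integral_dirichletBlock a hh.le hx hn t
    · intro n
      have : Measurable fun u : ℝ => cexp (-(u * t * I)) := by fun_prop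
      exact ((hmeas n).mul this).aestronglyMeasurable
    · simpa [enorm_mul, hexp] using hsum1
  exact ⟨hInt, htrans⟩

open MeasureTheory in
/-- A mean value estimate for Dirichlet series weighted by `expKernel`. -/
theorem lintegral_LSeries_mul_expKernel_le {a : ℕ → ℂ} (ha0 : a 0 = 0) {x h : ℝ} (hx : 0 < x)
    (hh : 0 < h) (ha : LSeriesSummable a x) :
    ∫⁻ t : ℝ, ‖LSeries a (x + t * I) * expKernel h (x + t * I)‖ₑ ^ 2 ≤
      ENNReal.ofReal (2 * π * h * rexp (2 * x * h)) *
        ∑' n : ℕ, ENNReal.ofReal (‖a n‖ ^ 2 * (1 + n * (rexp h - 1)) / n ^ (2 * x)) := by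
  set F := dirichletBlock a h x with hFdef
  have hF0 : F 0 = 0 := by
    ext u; simp [hFdef, dirichletBlock, ha0]
  have hmeas : ∀ n, Measurable (F n) := dirichletBlock_measurable a h x
  have hsupp : ∀ u, (Function.support fun n => F n u) ⊆
      (Finset.Ioc ⌊rexp u⌋₊ ⌊rexp (u + h)⌋₊ : Set ℕ) := dirichletBlock_support_subset ha0 h x
  set M : ℕ → ℝ := fun n => ‖a n‖ * rexp (x * h) / n ^ x with hM
  have hM0 : ∀ n, 0 ≤ M n := fun n => by positivity
  have hMF : ∀ n u, ‖F n u‖ ≤ (Set.Ico (Real.log n - h) (Real.log n)).indicator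
      (fun _ => M n) u := by
    intro n u
    rcases eq_or_ne n 0 with rfl | hn
    · rw [hF0]
      simp only [Pi.zero_apply, norm_zero]
      exact Set.indicator_nonneg (fun _ _ => hM0 0) _
    · exact norm_dirichletBlock_le a hx hn u
  have hl2 : ∀ n, ∫⁻ u, ‖F n u‖ₑ ^ 2 ≤ ENNReal.ofReal (M n ^ 2 * h) := by
    intro n
    calc ∫⁻ u, ‖F n u‖ₑ ^ 2 ≤ ∫⁻ u, (Set.Ico (Real.log n - h) (Real.log n)).indicator
          (fun _ => ENNReal.ofReal (M n ^ 2)) u := by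
          apply lintegral_mono
          intro u
          have := hMF n u
          by_cases hu : u ∈ Set.Ico (Real.log n - h) (Real.log n)
          · simp only [hu, Set.indicator_of_mem] at this ⊢
            rw [← ofReal_norm, ENNReal.ofReal_pow (hM0 n)]
            gcongr
          · simp only [hu, not_false_eq_true, Set.indicator_of_notMem] at this ⊢
            rw [← ofReal_norm]
            simpa using this
      _ = _ := by
          rw [lintegral_indicator measurableSet_Ico, lintegral_const, Measure.restrict_apply_univ,
            Real.volume_Ico, ENNReal.ofReal_mul (sq_nonneg _)]
          congr 2; ring
  obtain ⟨hInt, htrans⟩ := integrable_tsum_dirichletBlock ha0 hx hh ha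
  have hL2 : ∫⁻ u, ‖∑' n, F n u‖ₑ ^ 2 ≤
      ∑' n : ℕ, ENNReal.ofReal (1 + n * (rexp h - 1)) * ENNReal.ofReal (M n ^ 2 * h) := by
    have hpt : ∀ u, ‖∑' n, F n u‖ₑ ^ 2 ≤
        ∑' n : ℕ, ENNReal.ofReal (1 + n * (rexp h - 1)) * ‖F n u‖ₑ ^ 2 := by
      intro u
      set S := Finset.Ioc ⌊rexp u⌋₊ ⌊rexp (u + h)⌋₊
      have hη : 0 ≤ rexp h - 1 := by linarith [Real.add_one_le_exp h]
      have e1 : ∑' n, F n u = ∑ n ∈ S, F n u := by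
        apply tsum_eq_sum
        intro n hn
        by_contra hne
        exact hn (hsupp u hne)
      have e2 : ‖∑ n ∈ S, F n u‖ ^ 2 ≤ ∑ n ∈ S, (1 + n * (rexp h - 1)) * ‖F n u‖ ^ 2 := by
        calc ‖∑ n ∈ S, F n u‖ ^ 2 ≤ (∑ n ∈ S, ‖F n u‖) ^ 2 := by
              gcongr; exact norm_sum_le _ _
          _ ≤ S.card * ∑ n ∈ S, ‖F n u‖ ^ 2 := sq_sum_le_card_mul_sum_sq
          _ ≤ _ := by
              rw [Finset.mul_sum]
              apply Finset.sum_le_sum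
              intro n hn
              have h1 := card_Ioc_floor_exp_le (u := u) hh.le
              have h2 : rexp u ≤ n := by
                have := (Finset.mem_Ioc.1 hn).1
                exact ((Nat.floor_lt (Real.exp_pos _).le).1 this).le
              gcongr
              change ((Finset.Ioc ⌊rexp u⌋₊ ⌊rexp (u + h)⌋₊).card : ℝ) ≤ _
              nlinarith
      calc ‖∑' n, F n u‖ₑ ^ 2 = ENNReal.ofReal (‖∑ n ∈ S, F n u‖ ^ 2) := by
            rw [e1, ENNReal.ofReal_pow (norm_nonneg _), ofReal_norm]
        _ ≤ ENNReal.ofReal (∑ n ∈ S, (1 + n * (rexp h - 1)) * ‖F n u‖ ^ 2) :=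
            ENNReal.ofReal_le_ofReal e2
        _ = ∑ n ∈ S, ENNReal.ofReal (1 + n * (rexp h - 1)) * ‖F n u‖ₑ ^ 2 := by
            rw [ENNReal.ofReal_sum_of_nonneg (fun n _ => by positivity)]
            refine Finset.sum_congr rfl fun n _ => ?_
            rw [ENNReal.ofReal_mul (by positivity), ENNReal.ofReal_pow (norm_nonneg _), ofReal_norm]
        _ ≤ _ := ENNReal.sum_le_tsum _
    calc ∫⁻ u, ‖∑' n, F n u‖ₑ ^ 2
        ≤ ∫⁻ u, ∑' n : ℕ, ENNReal.ofReal (1 + n * (rexp h - 1)) * ‖F n u‖ₑ ^ 2 :=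
          lintegral_mono hpt
      _ = ∑' n : ℕ, ENNReal.ofReal (1 + n * (rexp h - 1)) * ∫⁻ u, ‖F n u‖ₑ ^ 2 := by
          rw [lintegral_tsum fun n => (((hmeas n).enorm.pow_const 2).const_mul _).aemeasurable]
          congr 1
          ext n
          rw [lintegral_const_mul _ ((hmeas n).enorm.pow_const 2)]
      _ ≤ _ := by
          gcongr with n
          exact hl2 n
  calc ∫⁻ t : ℝ, ‖LSeries a (x + t * I) * expKernel h (x + t * I)‖ₑ ^ 2
      = ∫⁻ t : ℝ, ‖∫ u : ℝ, (∑' n, F n u) * cexp (-(u * t * I))‖ₑ ^ 2 := by simp_rw [hFdef, htrans]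
    _ ≤ ENNReal.ofReal (2 * π) * ∫⁻ u, ‖∑' n, F n u‖ₑ ^ 2 := plancherel_le hInt
    _ ≤ ENNReal.ofReal (2 * π) *
        ∑' n : ℕ, ENNReal.ofReal (1 + n * (rexp h - 1)) * ENNReal.ofReal (M n ^ 2 * h) := by gcongr
    _ = _ := by
        rw [← ENNReal.tsum_mul_left, ← ENNReal.tsum_mul_left]
        congr 1
        ext n
        have hη : 0 ≤ rexp h - 1 := by linarith [Real.add_one_le_exp h]
        rw [← ENNReal.ofReal_mul (by positivity), ← ENNReal.ofReal_mul (by positivity),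
          ← ENNReal.ofReal_mul (by positivity)]
        congr 1
        simp only [hM, div_pow, mul_pow]
        rw [← Real.rpow_mul_natCast (by positivity), ← Real.exp_nat_mul]
        push_cast
        rw [show x * 2 = 2 * x by ring, show 2 * (x * h) = 2 * x * h by ring]
        ring

theorem card_divisors_sq_le (n : ℕ) :
    n.divisors.card ^ 2 ≤
      ∑ p ∈ n.divisorsAntidiagonal, p.1.divisors.card * p.2.divisors.card := by
  rcases eq_or_ne n 0 with rfl | hn
  · simp
  have h1 : ∑ p ∈ n.divisorsAntidiagonal, p.1.divisors.card * p.2.divisors.card =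
      (n.divisorsAntidiagonal.sigma (fun p => p.1.divisors ×ˢ p.2.divisors)).card := by
    rw [Finset.card_sigma]
    simp [Finset.card_product]
  rw [h1, sq, ← Finset.card_product]
  refine Finset.card_le_card_of_surjOn
    (fun x => (x.2.1 * x.2.2, x.2.1 * (x.1.2 / x.2.2))) ?_
  rintro ⟨a, b⟩ hab
  simp only [Finset.coe_product, Set.mem_prod, Finset.mem_coe, Nat.mem_divisors] at hab
  obtain ⟨⟨ha, -⟩, hb, -⟩ := hab
  have ha0 : 0 < a := Nat.pos_of_dvd_of_pos ha (Nat.pos_of_ne_zero hn)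
  have hb0 : 0 < b := Nat.pos_of_dvd_of_pos hb (Nat.pos_of_ne_zero hn)
  obtain ⟨a', b', hco, hga, hgb⟩ := Nat.exists_coprime a b
  set p := a.gcd b with hp
  have hp0 : 0 < p := Nat.gcd_pos_of_pos_left _ ha0
  have ha'0 : 0 < a' := by
    refine Nat.pos_of_ne_zero fun h => ha0.ne' ?_
    rw [hga, h, zero_mul]
  have hb'0 : 0 < b' := by
    refine Nat.pos_of_ne_zero fun h => hb0.ne' ?_
    rw [hgb, h, zero_mul]
  have hl : p * (a' * b') ∣ n := by
    have h2 : a.lcm b ∣ n := Nat.lcm_dvd ha hb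
    have h3 : p * a.lcm b = p * (p * (a' * b')) := by
      rw [hp, Nat.gcd_mul_lcm, ← hp]
      conv_lhs => rw [hga, hgb]
      ring
    rwa [Nat.eq_of_mul_eq_mul_left hp0 h3] at h2
  obtain ⟨k, hk⟩ := hl
  have hk0 : k ≠ 0 := by rintro rfl; simp at hk; exact hn hk
  refine ⟨⟨(p * k, a' * b'), (p, a')⟩, ?_, ?_⟩
  · simp only [Finset.mem_coe, Finset.mem_sigma, Nat.mem_divisorsAntidiagonal, Finset.mem_product,
      Nat.mem_divisors]
    refine ⟨⟨by rw [hk]; ring, hn⟩, ⟨Dvd.intro _ rfl, by positivity⟩, Dvd.intro _ rfl, by positivity⟩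
  · simp only [Prod.mk.injEq]
    rw [Nat.mul_div_cancel_left _ ha'0]
    exact ⟨by rw [hga]; ring, by rw [hgb]; ring⟩

theorem sum_range_inv_rpow_le (N : ℕ) :
    ∑ n ∈ Finset.range (N + 1), 1 / ((n + 1 : ℕ) : ℝ) ^ (3 / 2 : ℝ) ≤ 3 - 2 / √(N + 1) := by
  induction N with
  | zero => norm_num
  | succ N ih =>
    rw [Finset.sum_range_succ]
    have hx : (0:ℝ) < (N:ℝ) + 1 := by positivity
    set a := √((N:ℝ) + 1) with ha
    set b := √(((N + 1 : ℕ) : ℝ) + 1) with hb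
    have ha0 : 0 < a := Real.sqrt_pos.2 hx
    have hb0 : 0 < b := Real.sqrt_pos.2 (by positivity)
    have ha2 : a ^ 2 = N + 1 := Real.sq_sqrt hx.le
    have hb2 : b ^ 2 = N + 2 := by rw [hb, Real.sq_sqrt (by positivity)]; push_cast; ring
    have hb3 : ((N + 1 + 1 : ℕ) : ℝ) ^ (3 / 2 : ℝ) = b ^ 3 := by
      rw [hb, Real.sqrt_eq_rpow, ← Real.rpow_mul_natCast (by positivity)]
      push_cast
      norm_num
    rw [hb3]
    have key : 1 / b ^ 3 ≤ 2 / a - 2 / b := by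
      rw [div_sub_div _ _ ha0.ne' hb0.ne', div_le_div_iff₀ (by positivity) (by positivity)]
      have hab : a ≤ b := by
        apply le_of_sq_le_sq _ hb0.le
        linarith
      have h1 : (b - a) * (b + a) = 1 := by nlinarith
      have h2 : a * (b + a) ≤ 2 * b ^ 2 := by nlinarith
      have h3 : a ≤ 2 * b ^ 2 * (b - a) := by
        have : a * (b + a) * (b - a) ≤ 2 * b ^ 2 * (b - a) := by
          apply mul_le_mul_of_nonneg_right h2; linarith
        nlinarith
      nlinarith
    linarith

theorem norm_riemannZeta_three_halves_le : ‖riemannZeta (3 / 2 : ℝ)‖ ≤ 3 := by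
  have h1 : (1:ℝ) < (((3 / 2 : ℝ) : ℂ)).re := by rw [Complex.ofReal_re]; norm_num
  rw [zeta_eq_tsum_one_div_nat_add_one_cpow h1]
  have hterm : ∀ n : ℕ, ‖1 / ((n:ℂ) + 1) ^ (((3 / 2 : ℝ) : ℂ))‖ =
      1 / ((n + 1 : ℕ) : ℝ) ^ (3 / 2 : ℝ) := by
    intro n
    rw [norm_div, norm_one, show (n:ℂ) + 1 = ((n + 1 : ℕ) : ℂ) by push_cast; ring,
      Complex.norm_natCast_cpow_of_pos (by omega), Complex.ofReal_re]
  have hs : Summable fun n : ℕ => 1 / ((n + 1 : ℕ) : ℝ) ^ (3 / 2 : ℝ) :=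
    (summable_nat_add_iff (f := fun n : ℕ => 1 / (n:ℝ) ^ (3 / 2 : ℝ)) 1).2
      (Real.summable_one_div_nat_rpow.2 (by norm_num))
  refine (norm_tsum_le_tsum_norm (by simpa only [hterm] using hs)).trans ?_
  simp only [hterm]
  refine Real.tsum_le_of_sum_range_le (fun n => by positivity) fun N => ?_
  calc _ ≤ ∑ n ∈ Finset.range (N + 1), 1 / ((n + 1 : ℕ) : ℝ) ^ (3 / 2 : ℝ) := by
        apply Finset.sum_le_sum_of_subset_of_nonneg
        · exact Finset.range_subset_range.2 (by omega)
        · intros; positivity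
    _ ≤ _ := (sum_range_inv_rpow_le N).trans (by
        have : 0 ≤ 2 / √((N:ℝ) + 1) := by positivity
        linarith)

theorem summable_and_tsum_card_divisors_sq_le :
    Summable (fun n : ℕ => (n.divisors.card : ℝ) ^ 2 / (n:ℝ) ^ (3 / 2 : ℝ)) ∧
      ∑' n : ℕ, (n.divisors.card : ℝ) ^ 2 / (n:ℝ) ^ (3 / 2 : ℝ) ≤ 81 := by
  have h1 : (1:ℝ) < (((3 / 2 : ℝ) : ℂ)).re := by rw [Complex.ofReal_re]; norm_num
  have hs1 : LSeriesSummable 1 ((3 / 2 : ℝ) : ℂ) := LSeriesSummable_one_iff.2 h1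
  set D := LSeries.convolution (1 : ℕ → ℂ) 1 with hD
  have hDn : ∀ n, D n = (n.divisors.card : ℂ) := by
    intro n
    rw [hD, LSeries.convolution_def]
    simp [Nat.sum_divisorsAntidiagonal (fun _ _ => (1:ℂ))]
  set D2 := LSeries.convolution D D with hD2
  set D2R : ℕ → ℝ := fun n =>
    ∑ p ∈ n.divisorsAntidiagonal, (p.1.divisors.card : ℝ) * p.2.divisors.card with hD2R
  have hD2n : ∀ n, D2 n = (D2R n : ℂ) := by
    intro n
    rw [hD2, LSeries.convolution_def]
    simp [hDn, hD2R]
  have hs2 : LSeriesSummable D2 ((3 / 2 : ℝ) : ℂ) :=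
    (hs1.convolution hs1).convolution (hs1.convolution hs1)
  have hL : LSeries D2 ((3 / 2 : ℝ) : ℂ) = riemannZeta ((3 / 2 : ℝ) : ℂ) ^ 4 := by
    rw [hD2, LSeries_convolution' (hs1.convolution hs1) (hs1.convolution hs1),
      LSeries_convolution' hs1 hs1, LSeries_one_eq_riemannZeta h1]
    ring
  have hterm : ∀ n, LSeries.term D2 ((3 / 2 : ℝ) : ℂ) n =
      ((D2R n / (n:ℝ) ^ (3 / 2 : ℝ) : ℝ) : ℂ) := by
    intro n
    rcases eq_or_ne n 0 with rfl | hn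
    · simp [hD2R]
    · rw [LSeries.term_of_ne_zero hn, hD2n, ← Complex.ofReal_natCast, ← Complex.ofReal_cpow
        (by positivity), ← Complex.ofReal_div]
  have hsR : Summable fun n : ℕ => D2R n / (n:ℝ) ^ (3 / 2 : ℝ) := by
    rw [← Complex.summable_ofReal]
    exact hs2.congr hterm
  have hle : ∀ n : ℕ, (n.divisors.card : ℝ) ^ 2 / (n:ℝ) ^ (3 / 2 : ℝ) ≤
      D2R n / (n:ℝ) ^ (3 / 2 : ℝ) := by
    intro n
    have := card_divisors_sq_le n
    gcongr
    simp only [hD2R]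
    exact_mod_cast this
  have hsum := Summable.of_nonneg_of_le (fun n => by positivity) hle hsR
  refine ⟨hsum, (hsum.tsum_le_tsum hle hsR).trans ?_⟩
  have h2 : ((∑' n : ℕ, D2R n / (n:ℝ) ^ (3 / 2 : ℝ) : ℝ) : ℂ) =
      riemannZeta ((3 / 2 : ℝ) : ℂ) ^ 4 := by
    rw [Complex.ofReal_tsum, ← hL, LSeries]
    simp only [hterm]
  have h3 := congrArg norm h2
  rw [norm_pow, Complex.norm_real] at h3
  calc _ ≤ ‖∑' n : ℕ, D2R n / (n:ℝ) ^ (3 / 2 : ℝ)‖ := Real.le_norm_self _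
    _ = ‖riemannZeta ((3 / 2 : ℝ) : ℂ)‖ ^ 4 := h3
    _ ≤ 3 ^ 4 := by gcongr; exact norm_riemannZeta_three_halves_le
    _ = 81 := by norm_num

theorem abs_moebius_cast_le_one (n : ℕ) : ‖(ArithmeticFunction.moebius n : ℂ)‖ ≤ 1 := by
  have := ArithmeticFunction.abs_moebius_le_one (n := n)
  rw [Complex.norm_intCast]
  exact_mod_cast this

/-- The coefficients of the mollifier `MX X`. -/
noncomputable def mollifierCoeff (X : ℝ) (n : ℕ) : ℂ :=
  if n ∈ Finset.Icc 1 ⌊X⌋₊ then (ArithmeticFunction.moebius n : ℂ) else 0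

theorem norm_mollifierCoeff_le (X : ℝ) (n : ℕ) : ‖mollifierCoeff X n‖ ≤ 1 := by
  unfold mollifierCoeff
  split_ifs
  · exact abs_moebius_cast_le_one n
  · simp

theorem mollifierCoeff_term_eq_zero (X : ℝ) (s : ℂ) {n : ℕ} (hn : n ∉ Finset.Icc 1 ⌊X⌋₊) :
    LSeries.term (mollifierCoeff X) s n = 0 := by
  simp [LSeries.term, mollifierCoeff, hn]

theorem mollifierCoeff_LSeriesSummable (X : ℝ) (s : ℂ) : LSeriesSummable (mollifierCoeff X) s :=
  summable_of_ne_finset_zero (s := Finset.Icc 1 ⌊X⌋₊) fun _ hn => mollifierCoeff_term_eq_zero X s hn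

theorem mollifierCoeff_LSeries (X : ℝ) (s : ℂ) : LSeries (mollifierCoeff X) s = MX X s := by
  rw [LSeries, tsum_eq_sum (s := Finset.Icc 1 ⌊X⌋₊) fun _ hn => mollifierCoeff_term_eq_zero X s hn,
    MX]
  refine Finset.sum_congr rfl fun n hn => ?_
  rw [LSeries.term_of_ne_zero (by have := (Finset.mem_Icc.1 hn).1; omega), mollifierCoeff,
    if_pos hn, Complex.cpow_neg, div_eq_mul_inv]

/-- The coefficients of `fX X`. -/
noncomputable def mollifiedCoeff (X : ℝ) : ℕ → ℂ :=
  LSeries.convolution 1 (mollifierCoeff X) - LSeries.delta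

theorem mollifiedCoeff_zero (X : ℝ) : mollifiedCoeff X 0 = 0 := by
  simp [mollifiedCoeff, LSeries.delta, LSeries.convolution_def]

theorem mollifiedCoeff_eq_zero {X : ℝ} {n : ℕ} (hn : (n : ℝ) ≤ X) :
    mollifiedCoeff X n = 0 := by
  rcases eq_or_ne n 0 with rfl | hn0
  · exact mollifiedCoeff_zero X
  have h1 : LSeries.convolution (1 : ℕ → ℂ) (mollifierCoeff X) n =
      ∑ p ∈ n.divisorsAntidiagonal, (ArithmeticFunction.moebius p.2 : ℂ) := by
    rw [LSeries.convolution_def]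
    refine Finset.sum_congr rfl fun p hp => ?_
    rw [Pi.one_apply, one_mul, mollifierCoeff, if_pos]
    have h2 := Nat.divisor_le (Nat.snd_mem_divisors_of_mem_antidiagonal hp)
    have h3 := Nat.pos_of_mem_divisors (Nat.snd_mem_divisors_of_mem_antidiagonal hp)
    rw [Finset.mem_Icc]
    exact ⟨h3, h2.trans (Nat.le_floor hn)⟩
  have h4 := congrArg (fun f : ArithmeticFunction ℤ => f n) ArithmeticFunction.coe_zeta_mul_moebius
  simp only [ArithmeticFunction.mul_apply] at h4
  have h5 : ∑ p ∈ n.divisorsAntidiagonal, ArithmeticFunction.moebius p.2 =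
      (1 : ArithmeticFunction ℤ) n := by
    rw [← h4]
    refine Finset.sum_congr rfl fun p hp => ?_
    have h3 := Nat.pos_of_mem_divisors (Nat.fst_mem_divisors_of_mem_antidiagonal hp)
    simp [ArithmeticFunction.natCoe_apply, ArithmeticFunction.zeta_apply, h3.ne']
  rw [mollifiedCoeff, Pi.sub_apply, h1, ← Int.cast_sum, h5, LSeries.delta,
    ArithmeticFunction.one_apply]
  split_ifs <;> simp

theorem norm_mollifiedCoeff_le {X : ℝ} (hX : 1 ≤ X) (n : ℕ) :
    ‖mollifiedCoeff X n‖ ≤ n.divisors.card := by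
  by_cases hn : (n : ℝ) ≤ X
  · rw [mollifiedCoeff_eq_zero hn]
    simp
  · have hn1 : n ≠ 1 := by
      rintro rfl
      simp at hn
      linarith
    rw [mollifiedCoeff, Pi.sub_apply, LSeries.delta, if_neg hn1, sub_zero, LSeries.convolution_def]
    refine (norm_sum_le _ _).trans ?_
    calc ∑ p ∈ n.divisorsAntidiagonal, ‖(1 : ℕ → ℂ) p.1 * mollifierCoeff X p.2‖
        ≤ ∑ p ∈ n.divisorsAntidiagonal, (1:ℝ) := by
          apply Finset.sum_le_sum
          intro p _
          simpa using norm_mollifierCoeff_le X p.2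
      _ = _ := by
          rw [Nat.sum_divisorsAntidiagonal (fun _ _ => (1:ℝ))]
          simp

theorem delta_LSeriesSummable (s : ℂ) : LSeriesSummable LSeries.delta s :=
  summable_of_ne_finset_zero (s := {1}) fun n hn => by
      rw [Finset.mem_singleton] at hn
      simp [LSeries.term, LSeries.delta, hn]

theorem mollifiedCoeff_LSeriesSummable (X : ℝ) {s : ℂ} (hs : 1 < s.re) :
    LSeriesSummable (mollifiedCoeff X) s :=
  ((LSeriesSummable_one_iff.2 hs).convolution (mollifierCoeff_LSeriesSummable X s)).sub
    (delta_LSeriesSummable s)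

theorem mollifiedCoeff_LSeries (X : ℝ) {s : ℂ} (hs : 1 < s.re) :
    LSeries (mollifiedCoeff X) s = fX X s := by
  have h1 := LSeriesSummable_one_iff.2 hs
  have h2 := mollifierCoeff_LSeriesSummable X s
  rw [mollifiedCoeff, LSeries_sub (h1.convolution h2) (delta_LSeriesSummable s),
    LSeries_convolution' h1 h2, LSeries_one_eq_riemannZeta hs, mollifierCoeff_LSeries, LSeries_delta]
  rfl

/-- A version of `lintegral_LSeries_mul_expKernel_le` with a bound on the coefficient sum. -/
theorem lintegral_LSeries_mul_expKernel_le_of_tsum_le {a : ℕ → ℂ} (ha0 : a 0 = 0) {x h : ℝ}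
    (hx : 0 < x) (hh : 0 < h) (ha : LSeriesSummable a x) {b : ℕ → ℝ}
    (hab : ∀ n : ℕ, ‖a n‖ ^ 2 * (1 + n * (rexp h - 1)) / n ^ (2 * x) ≤ b n) (hb : Summable b) :
    ∫⁻ t : ℝ, ‖LSeries a (x + t * I) * expKernel h (x + t * I)‖ₑ ^ 2 ≤
      ENNReal.ofReal (2 * π * h * rexp (2 * x * h) * ∑' n, b n) := by
  refine (lintegral_LSeries_mul_expKernel_le ha0 hx hh ha).trans ?_
  rw [ENNReal.ofReal_mul (p := 2 * π * h * rexp (2 * x * h)) (by positivity)]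
  gcongr
  have hη : 0 ≤ rexp h - 1 := by linarith [Real.add_one_le_exp h]
  rw [ENNReal.ofReal_tsum_of_nonneg (fun n => le_trans (by positivity) (hab n)) hb]
  exact ENNReal.tsum_le_tsum fun n => ENNReal.ofReal_le_ofReal (hab n)

theorem lintegral_expKernel_le {x h : ℝ} (hx : 0 < x) (hh : 0 < h) :
    ∫⁻ t : ℝ, ‖expKernel h (x + t * I)‖ₑ ^ 2 ≤
      ENNReal.ofReal (2 * π * h * rexp ((2 * x + 1) * h)) := by
  have h1 := lintegral_LSeries_mul_expKernel_le_of_tsum_le (a := LSeries.delta)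
    (by simp [LSeries.delta]) hx hh (delta_LSeriesSummable _)
    (b := fun n => if n = 1 then rexp h else 0) (by
      intro n
      simp only [LSeries.delta]
      split_ifs with hn
      · simp [hn]
      · simp) (summable_of_ne_finset_zero (s := {1}) (by simp))
  rw [tsum_ite_eq] at h1
  simp only [LSeries_delta, Pi.one_apply, one_mul] at h1
  rw [mul_assoc, ← Real.exp_add] at h1
  rwa [show (2 * x + 1) * h = 2 * x * h + h by ring]

theorem lintegral_MX_mul_expKernel_le {X h : ℝ} (hX : 1 ≤ X) (hh : 0 < h) :
    ∫⁻ t : ℝ, ‖MX X ((1 / 2 : ℝ) + t * I) * expKernel h ((1 / 2 : ℝ) + t * I)‖ₑ ^ 2 ≤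
      ENNReal.ofReal (2 * π * h * rexp h * (1 + Real.log X + X * (rexp h - 1))) := by
  have hη : 0 ≤ rexp h - 1 := by linarith [Real.add_one_le_exp h]
  have h1 := lintegral_LSeries_mul_expKernel_le_of_tsum_le (a := mollifierCoeff X) (x := 1 / 2)
    (by simp [mollifierCoeff]) (by norm_num) hh (mollifierCoeff_LSeriesSummable X _)
    (b := fun n : ℕ => if n ∈ Finset.Icc 1 ⌊X⌋₊ then (1 / n + (rexp h - 1) : ℝ) else 0) (by
      intro n
      by_cases hn : n ∈ Finset.Icc 1 ⌊X⌋₊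
      · have hn0 : (0:ℝ) < n := by
          have := (Finset.mem_Icc.1 hn).1
          exact_mod_cast this
        rw [if_pos hn, mul_one_div_cancel two_ne_zero, Real.rpow_one]
        have h2 : ‖mollifierCoeff X n‖ ^ 2 ≤ 1 :=
          pow_le_one₀ (norm_nonneg _) (norm_mollifierCoeff_le X n)
        rw [div_le_iff₀ hn0, add_mul, one_div_mul_cancel hn0.ne', mul_comm _ (n:ℝ)]
        exact mul_le_of_le_one_left (by positivity) h2
      · simp [mollifierCoeff, hn]) (summable_of_ne_finset_zero (s := Finset.Icc 1 ⌊X⌋₊) (by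
        intro n hn; simp only [hn, if_false]))
  simp only [mollifierCoeff_LSeries] at h1
  refine h1.trans (ENNReal.ofReal_le_ofReal ?_)
  rw [show 2 * (1 / 2) * h = h by ring]
  gcongr
  rw [tsum_eq_sum (s := Finset.Icc 1 ⌊X⌋₊) (by intro n hn; simp only [hn, if_false])]
  have h3 := harmonic_floor_le_one_add_log X hX
  have h4 : (⌊X⌋₊ : ℝ) ≤ X := Nat.floor_le (by linarith)
  calc _ = ∑ n ∈ Finset.Icc 1 ⌊X⌋₊, (1 / n + (rexp h - 1) : ℝ) :=
        Finset.sum_congr rfl fun n hn => if_pos hn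
    _ = (harmonic ⌊X⌋₊ : ℝ) + ⌊X⌋₊ * (rexp h - 1) := by
        rw [Finset.sum_add_distrib, harmonic_eq_sum_Icc]
        simp
        ring
    _ ≤ _ := by gcongr

theorem lintegral_fX_mul_expKernel_le {X h x : ℝ} (hX : 1 ≤ X) (hh : 0 < h) (hx : 5 / 4 ≤ x) :
    ∫⁻ t : ℝ, ‖fX X (x + t * I) * expKernel h (x + t * I)‖ₑ ^ 2 ≤
      ENNReal.ofReal (2 * π * h * rexp (2 * x * h) * (81 * (1 / X + (rexp h - 1)))) := by
  have hη : 0 ≤ rexp h - 1 := by linarith [Real.add_one_le_exp h]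
  obtain ⟨hs, hS⟩ := summable_and_tsum_card_divisors_sq_le
  have hre : ∀ t : ℝ, 1 < ((x:ℂ) + t * I).re := by
    intro t; simp; linarith
  have h1 := lintegral_LSeries_mul_expKernel_le_of_tsum_le (a := mollifiedCoeff X) (x := x)
    (mollifiedCoeff_zero X) (by linarith) hh
    (mollifiedCoeff_LSeriesSummable X (by simp; linarith))
    (b := fun n : ℕ => (n.divisors.card : ℝ) ^ 2 / (n:ℝ) ^ (3 / 2 : ℝ) * (1 / X + (rexp h - 1))) (by
      intro n
      by_cases hn : (n:ℝ) ≤ X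
      · rw [mollifiedCoeff_eq_zero hn]
        simp only [norm_zero, ne_eq, OfNat.ofNat_ne_zero, not_false_eq_true, zero_pow, zero_mul,
          zero_div]
        positivity
      · push Not at hn
        have hn0 : (1:ℝ) ≤ n := by linarith
        have hn1 : (0:ℝ) < n := by linarith
        have h2 : ‖mollifiedCoeff X n‖ ^ 2 ≤ (n.divisors.card : ℝ) ^ 2 := by
          gcongr
          exact norm_mollifiedCoeff_le hX n
        have h3 : (1 + n * (rexp h - 1)) / n ^ (2 * x) ≤
            (1 / X + (rexp h - 1)) / (n:ℝ) ^ (3 / 2 : ℝ) := by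
          have h4 : (n:ℝ) ^ (2 * x) ≥ n * (n:ℝ) ^ (3 / 2 : ℝ) := by
            calc (n:ℝ) * (n:ℝ) ^ (3 / 2 : ℝ) = (n:ℝ) ^ (5 / 2 : ℝ) := by
                  rw [← Real.rpow_one_add' (by positivity) (by norm_num)]
                  norm_num
              _ ≤ _ := Real.rpow_le_rpow_of_exponent_le hn0 (by linarith)
          calc (1 + n * (rexp h - 1)) / n ^ (2 * x)
              ≤ (1 + n * (rexp h - 1)) / (n * (n:ℝ) ^ (3 / 2 : ℝ)) := by gcongr
            _ = (1 / n + (rexp h - 1)) / (n:ℝ) ^ (3 / 2 : ℝ) := by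
                field_simp
            _ ≤ _ := by gcongr
        calc _ = ‖mollifiedCoeff X n‖ ^ 2 * ((1 + n * (rexp h - 1)) / n ^ (2 * x)) := by
              rw [mul_div_assoc]
          _ ≤ (n.divisors.card : ℝ) ^ 2 * ((1 / X + (rexp h - 1)) / (n:ℝ) ^ (3 / 2 : ℝ)) := by
              gcongr
          _ = _ := by ring) (hs.mul_right _)
  rw [tsum_mul_right] at h1
  have h2 : ∀ t : ℝ, LSeries (mollifiedCoeff X) (x + t * I) = fX X (x + t * I) :=
    fun t => mollifiedCoeff_LSeries X (hre t)
  simp only [h2] at h1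
  refine h1.trans (ENNReal.ofReal_le_ofReal ?_)
  gcongr

theorem norm_fX_le {X : ℝ} (hX : 1 ≤ X) {s : ℂ} (hs : s.re = 2) : ‖fX X s‖ ≤ 81 / √X := by
  have hs1 : 1 < s.re := by rw [hs]; norm_num
  obtain ⟨hsum, hS⟩ := summable_and_tsum_card_divisors_sq_le
  rw [← mollifiedCoeff_LSeries X hs1, LSeries]
  have hle : ∀ n, ‖LSeries.term (mollifiedCoeff X) s n‖ ≤
      (n.divisors.card : ℝ) ^ 2 / (n:ℝ) ^ (3 / 2 : ℝ) * (1 / √X) := by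
    intro n
    rw [LSeries.norm_term_eq]
    by_cases hn : (n:ℝ) ≤ X
    · rw [mollifiedCoeff_eq_zero hn]
      simp only [norm_zero, zero_div, ite_self]
      positivity
    · push Not at hn
      have hn1 : (0:ℝ) < n := by linarith
      have hn0 : n ≠ 0 := by rintro rfl; simp at hn1
      rw [if_neg hn0, hs]
      have h1 : (1:ℝ) ≤ n.divisors.card := by
        exact_mod_cast Finset.card_pos.2 (Nat.nonempty_divisors.2 hn0)
      have h2 : (n:ℝ) ^ (2:ℝ) = (n:ℝ) ^ (3 / 2 : ℝ) * √n := by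
        rw [Real.sqrt_eq_rpow, ← Real.rpow_add hn1]
        norm_num
      calc ‖mollifiedCoeff X n‖ / (n:ℝ) ^ (2:ℝ) ≤ (n.divisors.card : ℝ) / (n:ℝ) ^ (2:ℝ) := by
            gcongr
            exact norm_mollifiedCoeff_le hX n
        _ ≤ (n.divisors.card : ℝ) ^ 2 / ((n:ℝ) ^ (3 / 2 : ℝ) * √X) := by
            rw [h2]
            gcongr
            nlinarith
        _ = _ := by rw [div_mul_div_comm, mul_one]
  have hsum2 := hsum.mul_right (1 / √X)
  have hn := Summable.of_nonneg_of_le (fun n => norm_nonneg _) hle hsum2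
  refine (norm_tsum_le_tsum_norm hn).trans ((hn.tsum_le_tsum hle hsum2).trans ?_)
  rw [tsum_mul_right, div_eq_mul_one_div 81]
  exact mul_le_mul_of_nonneg_right hS (by positivity)

/-- The number of integers in `(e ^ u, e ^ (u + h)]`. -/
noncomputable def expCount (h u : ℝ) : ℝ := (⌊rexp (u + h)⌋₊ : ℝ) - ⌊rexp u⌋₊

/-- `expCount` with its main term removed for positive `u`. -/
noncomputable def expDefect (h u : ℝ) : ℝ :=
  expCount h u - (Set.Ioi 0).indicator (fun u => rexp u * (rexp h - 1)) u

theorem expCount_measurable (h : ℝ) : Measurable (expCount h) := by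
  unfold expCount
  have h1 : Measurable fun u : ℝ => ⌊rexp (u + h)⌋₊ :=
    Nat.measurable_floor.comp (by fun_prop)
  have h2 : Measurable fun u : ℝ => ⌊rexp u⌋₊ :=
    Nat.measurable_floor.comp (by fun_prop)
  exact (measurable_from_top.comp h1).sub (measurable_from_top.comp h2)

theorem expDefect_measurable (h : ℝ) : Measurable (expDefect h) := by
  apply (expCount_measurable h).sub
  apply Measurable.indicator _ measurableSet_Ioi
  fun_prop

theorem expCount_nonneg {h : ℝ} (hh : 0 ≤ h) (u : ℝ) : 0 ≤ expCount h u := by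
  have h1 : ⌊rexp u⌋₊ ≤ ⌊rexp (u + h)⌋₊ := Nat.floor_mono (Real.exp_le_exp.2 (by linarith))
  have : (⌊rexp u⌋₊ : ℝ) ≤ ⌊rexp (u + h)⌋₊ := by exact_mod_cast h1
  unfold expCount
  linarith

theorem expCount_eq_card {h : ℝ} (hh : 0 ≤ h) (u : ℝ) :
    expCount h u = ((Finset.Ioc ⌊rexp u⌋₊ ⌊rexp (u + h)⌋₊).card : ℝ) := by
  have h1 : ⌊rexp u⌋₊ ≤ ⌊rexp (u + h)⌋₊ := Nat.floor_mono (Real.exp_le_exp.2 (by linarith))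
  rw [Nat.card_Ioc, Nat.cast_sub h1, expCount]

theorem abs_expCount_sub_le (h u : ℝ) : |expCount h u - rexp u * (rexp h - 1)| ≤ 1 := by
  have h1 := Nat.floor_le (Real.exp_pos (u + h)).le
  have h2 := Nat.floor_le (Real.exp_pos u).le
  have h3 := Nat.lt_floor_add_one (rexp (u + h))
  have h4 := Nat.lt_floor_add_one (rexp u)
  unfold expCount
  rw [Real.exp_add] at *
  rw [abs_le]
  constructor <;> linarith

theorem abs_expDefect_le {h : ℝ} (hh : 0 ≤ h) (hh2 : rexp h ≤ 2) (u : ℝ) : |expDefect h u| ≤ 2 := by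
  have h1 := abs_expCount_sub_le h u
  unfold expDefect
  by_cases hu : u ∈ Set.Ioi (0:ℝ)
  · rw [Set.indicator_of_mem hu]
    linarith
  · rw [Set.indicator_of_notMem hu, sub_zero, abs_of_nonneg (expCount_nonneg hh u)]
    have h2 : rexp u ≤ 1 := Real.exp_le_one_iff.2 (not_lt.1 hu)
    have h3 : 0 ≤ rexp h - 1 := by linarith [Real.add_one_le_exp h]
    have := (abs_le.1 h1).2
    nlinarith [Real.exp_pos u]

theorem expDefect_eq_zero {h : ℝ} (hh : 0 ≤ h) {u : ℝ} (hu : u < -h) : expDefect h u = 0 := by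
  have h1 : rexp (u + h) < 1 := Real.exp_lt_one_iff.2 (by linarith)
  have h2 : rexp u < 1 := Real.exp_lt_one_iff.2 (by linarith)
  unfold expDefect expCount
  rw [Nat.floor_eq_zero.2 h1, Nat.floor_eq_zero.2 h2, Set.indicator_of_notMem (by
    simp only [Set.mem_Ioi, not_lt]; linarith)]
  simp

theorem tsum_dirichletBlock_one {h : ℝ} (hh : 0 < h) (x u : ℝ) :
    ∑' n, dirichletBlock (fun n => if n = 0 then 0 else 1) h x n u =
      expCount h u * cexp (-(x * u)) := by
  rw [tsum_eq_sum (s := Finset.Ioc ⌊rexp u⌋₊ ⌊rexp (u + h)⌋₊)]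
  · rw [Finset.sum_congr rfl (g := fun _ => cexp (-(x * u))), Finset.sum_const,
      expCount_eq_card hh.le, nsmul_eq_mul]
    · simp
    · intro n hn
      obtain ⟨h1, h2⟩ := Finset.mem_Ioc.1 hn
      have hn0 : n ≠ 0 := by omega
      have hn' : (0:ℝ) < n := by positivity
      rw [Nat.floor_lt (Real.exp_pos _).le] at h1
      rw [Nat.le_floor_iff (Real.exp_pos _).le] at h2
      unfold dirichletBlock
      rw [Set.indicator_of_mem]
      · simp [hn0]
      · exact ⟨by linarith [(Real.log_le_iff_le_exp hn').2 h2], (Real.lt_log_iff_exp_lt hn').2 h1⟩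
  · intro n hn
    by_contra hne
    exact hn (dirichletBlock_support_subset (by simp) h x u hne)

/-- The Laplace transform of `expDefect`, as a Mellin transform. -/
noncomputable def defectTransform (h : ℝ) (s : ℂ) : ℂ :=
  mellin (fun y => (expDefect h (-Real.log y) : ℂ)) s

open MeasureTheory in
theorem defectTransform_eq (h : ℝ) (s : ℂ) :
    defectTransform h s = ∫ u : ℝ, (expDefect h u : ℂ) * cexp (-(s * u)) := by
  rw [defectTransform, mellin_eq_fourier, Real.fourier_real_eq_integral_exp_smul]
  apply integral_congr_ae
  refine Eventually.of_forall fun u => ?_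
  simp only [smul_eq_mul, Real.log_exp, neg_neg, real_smul]
  rw [← mul_assoc, mul_comm]
  congr 1
  push_cast
  rw [← Complex.exp_add]
  congr 1
  conv_rhs => rw [← re_add_im s]
  have : (π : ℂ) ≠ 0 := by exact_mod_cast Real.pi_ne_zero
  field_simp
  ring

open MeasureTheory in
theorem defectTransform_differentiableAt {h : ℝ} (hh : 0 ≤ h) (hh2 : rexp h ≤ 2) {s : ℂ}
    (hs : 0 < s.re) : DifferentiableAt ℂ (defectTransform h) s := by
  have hmeas : Measurable fun y : ℝ => (expDefect h (-Real.log y) : ℂ) :=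
    Complex.measurable_ofReal.comp ((expDefect_measurable h).comp Real.measurable_log.neg)
  have hbd : ∀ y : ℝ, ‖(expDefect h (-Real.log y) : ℂ)‖ ≤ 2 := fun y => by
    rw [Complex.norm_real]; exact abs_expDefect_le hh hh2 _
  refine mellin_differentiableAt_of_isBigO_rpow (a := s.re + 1) (b := 0) ?_ ?_ (by linarith) ?_ hs
  · apply LocallyIntegrable.locallyIntegrableOn
    refine (locallyIntegrable_const (2:ℝ)).mono hmeas.aestronglyMeasurable ?_
    exact Eventually.of_forall fun y => by simpa using hbd y
  · apply Asymptotics.IsBigO.of_bound 1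
    filter_upwards [eventually_gt_atTop (rexp h)] with y hy
    have hy0 : 0 < y := (Real.exp_pos h).trans hy
    rw [expDefect_eq_zero hh (by linarith [(Real.lt_log_iff_exp_lt hy0).2 hy])]
    simp only [ofReal_zero, norm_zero]
    positivity
  · apply Asymptotics.IsBigO.of_bound 2
    exact Eventually.of_forall fun y => by simpa using hbd y

open MeasureTheory in
theorem integrable_indicator_exp {h : ℝ} : Integrable
    ((Set.Ioi (-(2 * h))).indicator fun u : ℝ => 2 * rexp (2 * h) * rexp (-(1 / 2) * u)) := by
  rw [integrable_indicator_iff measurableSet_Ioi]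
  exact (exp_neg_integrableOn_Ioi _ (by norm_num)).const_mul _

theorem norm_expDefect_mul_le {h : ℝ} (hh : 0 < h) (hh2 : rexp h ≤ 2) {s : ℂ} (hs : 1 / 2 ≤ s.re)
    (hs2 : s.re ≤ 3 / 2) (u : ℝ) : ‖(expDefect h u : ℂ) * cexp (-(s * u))‖ ≤
    (Set.Ioi (-(2 * h))).indicator (fun u : ℝ => 2 * rexp (2 * h) * rexp (-(1 / 2) * u)) u := by
  by_cases hu : u ∈ Set.Ioi (-(2 * h))
  · rw [Set.indicator_of_mem hu, norm_mul, Complex.norm_exp, Complex.norm_real, mul_assoc,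
      ← Real.exp_add]
    have hre : (-(s * u)).re = -(s.re * u) := by simp
    have hu' : -(2 * h) < u := hu
    gcongr
    · exact abs_expDefect_le hh.le hh2 u
    · rw [hre]
      nlinarith
  · rw [Set.indicator_of_notMem hu, expDefect_eq_zero hh.le (by
      simp only [Set.mem_Ioi, not_lt] at hu; linarith)]
    simp

theorem exists_norm_defectTransform_le {h : ℝ} (hh : 0 < h) (hh2 : rexp h ≤ 2) :
    ∃ K, ∀ s : ℂ, 1 / 2 ≤ s.re → s.re ≤ 3 / 2 → ‖defectTransform h s‖ ≤ K := by
  refine ⟨∫ u : ℝ, (Set.Ioi (-(2 * h))).indicator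
    (fun u : ℝ => 2 * rexp (2 * h) * rexp (-(1 / 2) * u)) u, fun s hs hs2 => ?_⟩
  rw [defectTransform_eq]
  exact MeasureTheory.norm_integral_le_of_norm_le integrable_indicator_exp
    (Eventually.of_forall fun u => norm_expDefect_mul_le hh hh2 hs hs2 u)

open MeasureTheory in
theorem defectTransform_eq_of_one_lt {h : ℝ} (hh : 0 < h) {s : ℂ} (hs : 1 < s.re) :
    defectTransform h s = riemannZeta s * expKernel h s - (rexp h - 1) / (s - 1) := by
  obtain ⟨x, t, rfl⟩ : ∃ x t : ℝ, s = x + t * I := ⟨s.re, s.im, (re_add_im s).symm⟩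
  have hx : 1 < x := by simpa using hs
  have hL : ∀ s : ℂ, LSeries (fun n : ℕ => if n = 0 then 0 else 1) s = LSeries 1 s :=
    LSeries_congr fun {n} hn => by simp [hn]
  have hsum : LSeriesSummable (fun n : ℕ => if n = 0 then 0 else 1) (x : ℂ) :=
    (LSeriesSummable_congr _ (g := 1) fun {n} hn => by simp [hn]).2
      (LSeriesSummable_one_iff.2 (by simpa using hx))
  obtain ⟨hInt, htr⟩ := integrable_tsum_dirichletBlock (by simp) (by linarith) hh hsum
  simp_rw [tsum_dirichletBlock_one hh] at hInt htr
  rw [← LSeries_one_eq_riemannZeta hs, ← hL, ← htr t, defectTransform_eq]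
  have hexp : ∀ u : ℝ, ‖cexp (-(u * t * I))‖ = 1 := by
    intro u
    rw [show -(u * t * I : ℂ) = ((-(u * t) : ℝ) : ℂ) * I by push_cast; ring,
      Complex.norm_exp_ofReal_mul_I]
  have hneg : (-((x:ℂ) + t * I - 1)).re < 0 := by simp; linarith
  have hint1 : Integrable fun u : ℝ => expCount h u * cexp (-(x * u)) * cexp (-(u * t * I)) := by
    refine hInt.mono (hInt.1.mul (by fun_prop)) (Eventually.of_forall fun u => ?_)
    rw [norm_mul, hexp, mul_one]
  have hint2 : Integrable ((Set.Ioi (0:ℝ)).indicator fun u : ℝ =>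
      ((rexp h - 1 : ℝ) : ℂ) * cexp (-((x:ℂ) + t * I - 1) * u)) := by
    rw [integrable_indicator_iff measurableSet_Ioi]
    exact (integrableOn_exp_mul_complex_Ioi hneg 0).const_mul _
  have hI : ∫ u : ℝ, (Set.Ioi (0:ℝ)).indicator (fun u : ℝ =>
      ((rexp h - 1 : ℝ) : ℂ) * cexp (-((x:ℂ) + t * I - 1) * u)) u =
      (rexp h - 1) / (x + t * I - 1) := by
    rw [integral_indicator measurableSet_Ioi, integral_const_mul,
      integral_exp_mul_complex_Ioi hneg]
    push_cast
    rw [mul_zero, Complex.exp_zero, neg_div_neg_eq]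
    ring
  rw [← hI, ← integral_sub hint1 hint2]
  congr 1
  ext u
  unfold expDefect
  have e1 : cexp (-((x + t * I : ℂ) * u)) = cexp (-(x * u)) * cexp (-(u * t * I)) := by
    rw [← Complex.exp_add]; congr 1; ring
  by_cases hu : u ∈ Set.Ioi (0:ℝ)
  · rw [Set.indicator_of_mem hu, Set.indicator_of_mem hu]
    have e2 : cexp (-((x:ℂ) + t * I - 1) * u) = cexp u * cexp (-((x + t * I : ℂ) * u)) := by
      rw [← Complex.exp_add]; congr 1; ring
    rw [e2, e1]
    push_cast
    ring
  · rw [Set.indicator_of_notMem hu, Set.indicator_of_notMem hu, e1]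
    push_cast
    ring

theorem expKernel_differentiableAt (h : ℝ) {s : ℂ} (hs : s ≠ 0) :
    DifferentiableAt ℂ (expKernel h) s := by
  unfold expKernel
  fun_prop (disch := exact hs)

theorem riemannZeta₁_mul_expKernel {h : ℝ} (hh : 0 < h) (hh2 : rexp h ≤ 2) {s : ℂ}
    (hs : 0 < s.re) :
    riemannZeta₁ s * expKernel h s = (s - 1) * defectTransform h s + (rexp h - 1) := by
  have hopen : IsOpen {s : ℂ | 0 < s.re} := isOpen_lt continuous_const Complex.continuous_re
  have hne : ∀ s : ℂ, 0 < s.re → s ≠ 0 := by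
    rintro s hs rfl
    simp at hs
  have h1 : AnalyticOnNhd ℂ (fun s => riemannZeta₁ s * expKernel h s) {s : ℂ | 0 < s.re} := by
    apply DifferentiableOn.analyticOnNhd _ hopen
    intro s hs
    exact ((differentiable_riemannZeta₁ s).mul
      (expKernel_differentiableAt h (hne s hs))).differentiableWithinAt
  have h2 : AnalyticOnNhd ℂ (fun s => (s - 1) * defectTransform h s + (rexp h - 1))
      {s : ℂ | 0 < s.re} := by
    apply DifferentiableOn.analyticOnNhd _ hopen
    intro s hs
    exact (((differentiableAt_id.sub_const 1).mul
      (defectTransform_differentiableAt hh.le hh2 hs)).add_const _).differentiableWithinAt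
  refine h1.eqOn_of_preconnected_of_eventuallyEq h2 (convex_halfSpace_re_gt 0).isPreconnected
    (z₀ := 2) (by simp) ?_ hs
  have hnhds : {s : ℂ | 1 < s.re} ∈ nhds (2:ℂ) :=
    (isOpen_lt continuous_const Complex.continuous_re).mem_nhds (by simp)
  filter_upwards [hnhds] with s hs
  have hs1 : s - 1 ≠ 0 := by
    intro h0
    have := congrArg Complex.re h0
    simp at this hs
    linarith
  rw [defectTransform_eq_of_one_lt hh hs, riemannZeta_eq_inv_sub_mul (sub_ne_zero.1 hs1)]
  field_simp
  ring

/-- `expCount` with its main term removed. -/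
noncomputable def expCountError (h u : ℝ) : ℝ := expCount h u - rexp u * (rexp h - 1)

open MeasureTheory in
theorem integrable_expCountError_mul {h : ℝ} (hh : 0 < h) (hh2 : rexp h ≤ 2) :
    Integrable (fun u : ℝ => (expCountError h u : ℂ) * cexp (-((1 / 2 : ℝ) * u))) ∧
    ∀ t : ℝ, t ≠ 0 →
      ∫ u : ℝ, (expCountError h u : ℂ) * cexp (-((1 / 2 : ℝ) * u)) * cexp (-(u * t * I)) =
        riemannZeta ((1 / 2 : ℝ) + t * I) * expKernel h ((1 / 2 : ℝ) + t * I) := by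
  have hI1 : ∀ t : ℝ, Integrable fun u : ℝ =>
      (expDefect h u : ℂ) * cexp (-(((1 / 2 : ℝ) + t * I : ℂ) * u)) := by
    intro t
    refine (integrable_indicator_exp (h := h)).mono'
      ((Complex.measurable_ofReal.comp (expDefect_measurable h)).mul
      (g := fun u : ℝ => cexp (-(((1 / 2 : ℝ) + t * I : ℂ) * u))) (by fun_prop)).aestronglyMeasurable
      (Eventually.of_forall fun u => ?_)
    exact norm_expDefect_mul_le hh hh2 (by simp) (by norm_num) u
  have hpos : ∀ t : ℝ, 0 < (1 - ((1 / 2 : ℝ) + t * I : ℂ)).re := by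
    intro t; simp; norm_num
  have hI2 : ∀ t : ℝ, Integrable ((Set.Iic (0:ℝ)).indicator fun u : ℝ =>
      ((rexp h - 1 : ℝ) : ℂ) * cexp ((1 - ((1 / 2 : ℝ) + t * I)) * u)) := by
    intro t
    rw [integrable_indicator_iff measurableSet_Iic]
    exact (integrableOn_exp_mul_complex_Iic (hpos t) 0).const_mul _
  have hdec : ∀ t u : ℝ, (expCountError h u : ℂ) * cexp (-((1 / 2 : ℝ) * u)) * cexp (-(u * t * I)) =
      (expDefect h u : ℂ) * cexp (-(((1 / 2 : ℝ) + t * I : ℂ) * u)) -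
      (Set.Iic (0:ℝ)).indicator (fun u : ℝ =>
      ((rexp h - 1 : ℝ) : ℂ) * cexp ((1 - ((1 / 2 : ℝ) + t * I)) * u)) u := by
    intro t u
    have e1 : cexp (-(((1 / 2 : ℝ) + t * I : ℂ) * u)) =
        cexp (-((1 / 2 : ℝ) * u)) * cexp (-(u * t * I)) := by
      rw [← Complex.exp_add]; congr 1; ring
    unfold expCountError expDefect
    by_cases hu : u ≤ 0
    · rw [Set.indicator_of_mem (Set.mem_Iic.2 hu),
        Set.indicator_of_notMem (s := Set.Ioi 0) (by simpa using hu), e1]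
      have e2 : cexp ((1 - ((1 / 2 : ℝ) + t * I)) * u) =
          cexp u * (cexp (-((1 / 2 : ℝ) * u)) * cexp (-(u * t * I))) := by
        rw [← Complex.exp_add, ← Complex.exp_add]; congr 1; ring
      rw [e2]
      push_cast
      ring
    · rw [Set.indicator_of_mem (Set.mem_Ioi.2 (not_le.1 hu)),
        Set.indicator_of_notMem (s := Set.Iic 0) (by simpa using hu), e1]
      push_cast
      ring
  constructor
  · have := (hI1 0).sub (hI2 0)
    refine this.congr (Eventually.of_forall fun u => ?_)
    have := hdec 0 u
    simp only [ofReal_zero, mul_zero, zero_mul, neg_zero, Complex.exp_zero, mul_one] at this ⊢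
    exact this.symm
  · intro t ht
    simp_rw [hdec t]
    rw [integral_sub (hI1 t) (hI2 t), ← defectTransform_eq, integral_indicator measurableSet_Iic,
      integral_const_mul, integral_exp_mul_complex_Iic (hpos t)]
    have hs1 : ((1 / 2 : ℝ) + t * I : ℂ) - 1 ≠ 0 := by
      intro h0
      have := congrArg Complex.im h0
      simp at this
      exact ht this
    have hs1' : 1 - ((1 / 2 : ℝ) + t * I : ℂ) ≠ 0 := by
      rw [← neg_sub]; exact neg_ne_zero.2 hs1
    have key := riemannZeta₁_mul_expKernel hh hh2 (s := (1 / 2 : ℝ) + t * I) (by simp)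
    rw [riemannZeta_eq_inv_sub_mul (sub_ne_zero.1 hs1), mul_assoc, key]
    simp only [ofReal_zero, mul_zero, Complex.exp_zero]
    set s : ℂ := (1 / 2 : ℝ) + t * I
    rw [show (1 - s) = -(s - 1) by ring]
    push_cast
    field_simp
    ring

theorem expCount_eq_sum_indicator {h : ℝ} (hh : 0 < h) {u : ℝ} {M : ℕ} (hM : ⌊rexp (u + h)⌋₊ ≤ M) :
    expCount h u = ∑ n ∈ Finset.Icc 1 M,
      (Set.Ico (Real.log n - h) (Real.log n)).indicator (fun _ => (1:ℝ)) u := by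
  rw [expCount_eq_card hh.le, Finset.card_eq_sum_ones, Nat.cast_sum]
  rw [← Finset.sum_subset (s₁ := Finset.Ioc ⌊rexp u⌋₊ ⌊rexp (u + h)⌋₊) (s₂ := Finset.Icc 1 M)]
  · refine Finset.sum_congr rfl fun n hn => ?_
    obtain ⟨h1, h2⟩ := Finset.mem_Ioc.1 hn
    have hn' : (0:ℝ) < n := by
      have : 0 < n := by omega
      exact_mod_cast this
    rw [Nat.floor_lt (Real.exp_pos _).le] at h1
    rw [Nat.le_floor_iff (Real.exp_pos _).le] at h2
    rw [Set.indicator_of_mem]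
    · simp
    · exact ⟨by linarith [(Real.log_le_iff_le_exp hn').2 h2], (Real.lt_log_iff_exp_lt hn').2 h1⟩
  · intro n hn
    obtain ⟨h1, h2⟩ := Finset.mem_Ioc.1 hn
    exact Finset.mem_Icc.2 ⟨by omega, h2.trans hM⟩
  · intro n hn hn2
    rw [Set.indicator_of_notMem]
    rintro ⟨h1, h2⟩
    apply hn2
    have hn' : (0:ℝ) < n := by
      have := (Finset.mem_Icc.1 hn).1
      exact_mod_cast this
    rw [Finset.mem_Ioc, Nat.floor_lt (Real.exp_pos _).le, Nat.le_floor_iff (Real.exp_pos _).le]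
    exact ⟨(Real.lt_log_iff_exp_lt hn').1 h2, (Real.log_le_iff_le_exp hn').1 (by linarith)⟩

theorem expCountError_sq_le {h : ℝ} (hh : 0 < h) {u : ℝ} (hu : rexp u * (rexp h - 1) < 1) :
    expCountError h u ^ 2 ≤ expCount h u + (rexp u * (rexp h - 1)) ^ 2 := by
  have h0 := expCount_nonneg hh.le u
  have h1 := abs_expCount_sub_le h u
  have h3 : 0 ≤ rexp u * (rexp h - 1) := by
    have := Real.add_one_le_exp h
    have := Real.exp_pos u
    apply mul_nonneg <;> linarith
  have h2 : expCount h u ≤ 1 := by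
    have h4 : expCount h u < 2 := by linarith [(abs_le.1 h1).2]
    rw [expCount_eq_card hh.le] at h4 ⊢
    have : (Finset.Ioc ⌊rexp u⌋₊ ⌊rexp (u + h)⌋₊).card < 2 := by exact_mod_cast h4
    exact_mod_cast Nat.le_of_lt_succ this
  unfold expCountError
  nlinarith

open MeasureTheory in
theorem lintegral_expCountError_le {h : ℝ} (hh : 0 < h) (hh2 : rexp h ≤ 2) :
    ∫⁻ u : ℝ, ‖(expCountError h u : ℂ) * cexp (-((1 / 2 : ℝ) * u))‖ₑ ^ 2 ≤
      ENNReal.ofReal (h * rexp h * (3 + h + Real.log h⁻¹)) := by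
  set η := rexp h - 1 with hη
  have hhη : h ≤ η := by linarith [Real.add_one_le_exp h]
  have hη0 : 0 < η := by linarith
  have hη1 : η ≤ 1 := by linarith
  have hηle : η ≤ h * rexp h := by
    have h1 := Real.add_one_le_exp (-h)
    have h2 : rexp h * rexp (-h) = 1 := by rw [← Real.exp_add]; simp
    have h3 := Real.exp_pos h
    nlinarith
  set U := -Real.log η with hU
  have hexpU : rexp U = η⁻¹ := by rw [hU, Real.exp_neg, Real.exp_log hη0]
  have hexpU' : rexp (-U) = η := by rw [hU, neg_neg, Real.exp_log hη0]
  set M := ⌊rexp (U + h)⌋₊ with hM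
  set G : ℕ → ℝ → ENNReal := fun n => (Set.Ico (Real.log n - h) (Real.log n)).indicator
    (fun _ => ENNReal.ofReal (rexp h / n)) with hG
  have hpt : ∀ u : ℝ, ‖(expCountError h u : ℂ) * cexp (-((1 / 2 : ℝ) * u))‖ₑ ^ 2 ≤
      (Set.Ioi U).indicator (fun u => ENNReal.ofReal (rexp (-u))) u +
      (Set.Iic U).indicator (fun u => ENNReal.ofReal (η ^ 2 * rexp u)) u +
      ∑ n ∈ Finset.Icc 1 M, G n u := by
    intro u
    have e1 : ‖(expCountError h u : ℂ) * cexp (-((1 / 2 : ℝ) * u))‖ₑ ^ 2 =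
        ENNReal.ofReal (expCountError h u ^ 2 * rexp (-u)) := by
      rw [← ofReal_norm, ← ENNReal.ofReal_pow (norm_nonneg _), norm_mul, Complex.norm_exp,
        Complex.norm_real, mul_pow, Real.norm_eq_abs, sq_abs, ← Real.exp_nat_mul]
      congr 3
      simp
    rw [e1]
    have hb : expCountError h u ^ 2 ≤ 1 := by
      rw [← sq_abs]
      exact pow_le_one₀ (abs_nonneg _) (abs_expCount_sub_le h u)
    rcases lt_or_ge U u with hu | hu
    · rw [Set.indicator_of_mem (Set.mem_Ioi.2 hu), add_assoc]
      refine le_trans (ENNReal.ofReal_le_ofReal ?_) le_self_add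
      nlinarith [Real.exp_pos (-u)]
    · rw [Set.indicator_of_notMem (by simpa using hu), Set.indicator_of_mem (Set.mem_Iic.2 hu),
        zero_add]
      have hle1 : rexp u * η ≤ 1 := by
        have : rexp u ≤ η⁻¹ := by rw [← hexpU]; exact Real.exp_le_exp.2 hu
        calc rexp u * η ≤ η⁻¹ * η := by gcongr
          _ = 1 := inv_mul_cancel₀ hη0.ne'
      have hmain : expCountError h u ^ 2 * rexp (-u) ≤ η ^ 2 * rexp u +
          ∑ n ∈ Finset.Icc 1 M, (Set.Ico (Real.log n - h) (Real.log n)).indicator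
            (fun _ => rexp h / n) u := by
        have hS : 0 ≤ ∑ n ∈ Finset.Icc 1 M, (Set.Ico (Real.log n - h) (Real.log n)).indicator
            (fun _ => rexp h / n) u := by
          refine Finset.sum_nonneg fun n _ => Set.indicator_nonneg (fun _ _ => by positivity) _
        have hpos := Real.exp_pos u
        have hinv : rexp u * rexp (-u) = 1 := by rw [← Real.exp_add]; simp
        rcases hle1.lt_or_eq with hlt | heq
        · have h1 := expCountError_sq_le hh hlt
          rw [expCount_eq_sum_indicator hh (M := M)
            (Nat.floor_mono (Real.exp_le_exp.2 (by linarith)))] at h1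
          calc expCountError h u ^ 2 * rexp (-u) ≤ (∑ n ∈ Finset.Icc 1 M,
                (Set.Ico (Real.log n - h) (Real.log n)).indicator (fun _ => (1:ℝ)) u +
                (rexp u * (rexp h - 1)) ^ 2) * rexp (-u) := by gcongr
            _ = η ^ 2 * rexp u + ∑ n ∈ Finset.Icc 1 M,
                (Set.Ico (Real.log n - h) (Real.log n)).indicator (fun _ => (1:ℝ)) u * rexp (-u) := by
                rw [add_mul, Finset.sum_mul, mul_pow, ← hη]
                linear_combination (rexp u * η ^ 2) * hinv
            _ ≤ _ := by
                gcongr with n hn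
                by_cases hm : u ∈ Set.Ico (Real.log n - h) (Real.log n)
                · rw [Set.indicator_of_mem hm, Set.indicator_of_mem hm, one_mul]
                  have hn0 : (0:ℝ) < n := by
                    exact_mod_cast (Finset.mem_Icc.1 hn).1
                  rw [← Real.exp_log hn0, ← Real.exp_sub]
                  exact Real.exp_le_exp.2 (by linarith [hm.1])
                · rw [Set.indicator_of_notMem hm, Set.indicator_of_notMem hm, zero_mul]
        · have : rexp (-u) = η ^ 2 * rexp u := by
            have : η * (rexp u * rexp (-u)) = η := by rw [hinv, mul_one]
            calc rexp (-u) = (rexp u * η) * rexp (-u) := by rw [heq, one_mul]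
              _ = η := by linarith
              _ = η * (rexp u * η) := by rw [heq, mul_one]
              _ = _ := by ring
          rw [← this]
          nlinarith [Real.exp_pos (-u)]
      refine (ENNReal.ofReal_le_ofReal hmain).trans ?_
      rw [ENNReal.ofReal_add (by positivity) (Finset.sum_nonneg fun n _ =>
        Set.indicator_nonneg (fun _ _ => by positivity) _), ENNReal.ofReal_sum_of_nonneg
        fun n _ => Set.indicator_nonneg (fun _ _ => by positivity) _]
      gcongr with n hn
      rw [hG]
      by_cases hm : u ∈ Set.Ico (Real.log n - h) (Real.log n)
      · simp only [Set.indicator_of_mem hm]; exact le_rfl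
      · simp only [Set.indicator_of_notMem hm, ENNReal.ofReal_zero]; exact le_rfl
  have i1 : ∫⁻ u, (Set.Ioi U).indicator (fun u => ENNReal.ofReal (rexp (-u))) u =
      ENNReal.ofReal η := by
    rw [lintegral_indicator measurableSet_Ioi, ← ofReal_integral_eq_lintegral_ofReal
      (by simpa [IntegrableOn] using exp_neg_integrableOn_Ioi U one_pos)
      (Eventually.of_forall fun u => (Real.exp_pos _).le), integral_exp_neg_Ioi, hexpU']
  have i2 : ∫⁻ u, (Set.Iic U).indicator (fun u => ENNReal.ofReal (η ^ 2 * rexp u)) u =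
      ENNReal.ofReal η := by
    rw [lintegral_indicator measurableSet_Iic, ← ofReal_integral_eq_lintegral_ofReal
      ((integrableOn_exp_Iic U).const_mul _)
      (Eventually.of_forall fun u => by positivity), integral_const_mul, integral_exp_Iic, hexpU]
    congr 1
    field_simp
  have i3 : ∀ n, ∫⁻ u, G n u = ENNReal.ofReal (rexp h / n * h) := by
    intro n
    rw [hG, lintegral_indicator measurableSet_Ico, lintegral_const, Measure.restrict_apply_univ,
      Real.volume_Ico, ENNReal.ofReal_mul (by positivity)]
    congr 2; ring
  have hM0 : Real.log M ≤ h + Real.log h⁻¹ := by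
    have hUle : U ≤ Real.log h⁻¹ := by
      rw [Real.log_inv, hU]
      exact neg_le_neg (Real.log_le_log hh hhη)
    rcases Nat.eq_zero_or_pos M with h0 | h0
    · rw [h0, Nat.cast_zero, Real.log_zero]
      have : 0 ≤ U := neg_nonneg.2 (Real.log_nonpos hη0.le hη1)
      linarith
    · calc Real.log M ≤ Real.log (rexp (U + h)) :=
            Real.log_le_log (by exact_mod_cast h0) (Nat.floor_le (Real.exp_pos _).le)
        _ ≤ _ := by rw [Real.log_exp]; linarith
  have hmG : ∀ n, Measurable (G n) := fun n => measurable_const.indicator measurableSet_Ico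
  have hm1 : Measurable ((Set.Ioi U).indicator fun u => ENNReal.ofReal (rexp (-u))) :=
    Measurable.indicator (by fun_prop) measurableSet_Ioi
  have hm2 : Measurable ((Set.Iic U).indicator fun u => ENNReal.ofReal (η ^ 2 * rexp u)) :=
    Measurable.indicator (by fun_prop) measurableSet_Iic
  calc _ ≤ _ := lintegral_mono hpt
    _ = ENNReal.ofReal (η + η + ∑ n ∈ Finset.Icc 1 M, rexp h / n * h) := by
        rw [lintegral_add_right _ (Finset.measurable_fun_sum _ fun n _ => hmG n), lintegral_add_left hm1, i1, i2,
          lintegral_finsetSum _ fun n _ => hmG n, Finset.sum_congr rfl fun n _ => i3 n,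
          ENNReal.ofReal_add (by positivity) (Finset.sum_nonneg fun n _ => by positivity),
          ENNReal.ofReal_add hη0.le hη0.le, ENNReal.ofReal_sum_of_nonneg fun n _ => by positivity]
    _ ≤ _ := by
        apply ENNReal.ofReal_le_ofReal
        have hs : ∑ n ∈ Finset.Icc 1 M, rexp h / n * h = h * rexp h * (harmonic M : ℝ) := by
          rw [harmonic_eq_sum_Icc, Rat.cast_sum, Finset.mul_sum]
          refine Finset.sum_congr rfl fun n _ => ?_
          push_cast
          ring
        have hhar := harmonic_le_one_add_log M
        have : h * rexp h * (harmonic M : ℝ) ≤ h * rexp h * (1 + (h + Real.log h⁻¹)) := by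
          gcongr
          linarith
        rw [hs]
        linarith

open MeasureTheory in
theorem lintegral_riemannZeta_mul_expKernel_le {h : ℝ} (hh : 0 < h) (hh2 : rexp h ≤ 2) :
    ∫⁻ t : ℝ, ‖riemannZeta ((1 / 2 : ℝ) + t * I) * expKernel h ((1 / 2 : ℝ) + t * I)‖ₑ ^ 2 ≤
      ENNReal.ofReal (2 * π * (h * rexp h * (3 + h + Real.log h⁻¹))) := by
  obtain ⟨h1, h2⟩ := integrable_expCountError_mul hh hh2
  rw [ENNReal.ofReal_mul (by positivity)]
  calc _ = ∫⁻ t : ℝ, ‖∫ u : ℝ, (expCountError h u : ℂ) * cexp (-((1 / 2 : ℝ) * u)) *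
        cexp (-(u * t * I))‖ₑ ^ 2 := by
        apply lintegral_congr_ae
        have : ∀ᵐ t : ℝ, t ≠ 0 := by simp [ae_iff]
        filter_upwards [this] with t ht
        rw [h2 t ht]
    _ ≤ _ := plancherel_le h1
    _ ≤ _ := by
        gcongr
        exact lintegral_expCountError_le hh hh2

open MeasureTheory in
theorem hasDerivAt_integral_translate {F : ℂ → ℂ} (hF : DifferentiableOn ℂ F {s | 0 < s.re})
    {g : ℝ → ℂ} (hg : Measurable g) (hg1 : ∀ t, ‖g t‖ ≤ 1) (Y : ℝ) {z : ℂ} (hz : 0 < z.re) :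
    DifferentiableAt ℂ (fun z => ∫ t in Set.Icc (-Y) Y, F (z + t * I) * g t) z := by
  have hopen : IsOpen {s : ℂ | 0 < s.re} := isOpen_lt continuous_const Complex.continuous_re
  have hre : ∀ (w : ℂ) (t : ℝ), (w + t * I).re = w.re := fun w t => by simp
  have hcont : ∀ w : ℂ, 0 < w.re → Continuous fun t : ℝ => F (w + t * I) := fun w hw =>
    hF.continuousOn.comp_continuous (by fun_prop) fun t => by simpa using hw
  have hcont' : ∀ w : ℂ, 0 < w.re → Continuous fun t : ℝ => deriv F (w + t * I) := fun w hw =>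
    (hF.deriv hopen).continuousOn.comp_continuous (by fun_prop) fun t => by simpa using hw
  set ε := z.re / 2
  have hball : ∀ w ∈ Metric.closedBall z ε, 0 < w.re := by
    intro w hw
    have h1 := (Complex.abs_re_le_norm (w - z)).trans (mem_closedBall_iff_norm.1 hw)
    have h2 := (abs_le.1 h1).1
    simp only [sub_re, ε] at h2
    linarith
  obtain ⟨K, hK⟩ := (((isCompact_closedBall z ε).prod (isCompact_Icc (a := -Y) (b := Y))).image
    (f := fun p : ℂ × ℝ => p.1 + p.2 * I) (by fun_prop)).exists_bound_of_continuousOn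
    (f := deriv F) ((hF.deriv hopen).continuousOn.mono (by
      rintro _ ⟨⟨w, t⟩, ⟨hw, ht⟩, rfl⟩
      simpa using hball w hw))
  have hInt : Integrable (fun _ : ℝ => K) (volume.restrict (Set.Icc (-Y) Y)) := by
    simp
  refine (hasDerivAt_integral_of_dominated_loc_of_deriv_le (bound := fun _ => K)
    (F' := fun z (t : ℝ) => deriv F (z + t * I) * g t) (s := Metric.closedBall z ε)
    (Metric.closedBall_mem_nhds z (by positivity)) ?_ ?_ ?_ ?_ hInt ?_).2.differentiableAt
  · filter_upwards [Metric.closedBall_mem_nhds z (show 0 < ε by positivity)] with w hw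
    exact ((hcont w (hball w hw)).measurable.mul hg).aestronglyMeasurable
  · have := (hcont z hz).continuousOn.integrableOn_Icc (μ := volume) (a := -Y) (b := Y)
    refine Integrable.mono this ((hcont z hz).measurable.mul hg).aestronglyMeasurable
      (Eventually.of_forall fun t => ?_)
    rw [norm_mul]
    exact mul_le_of_le_one_right (norm_nonneg _) (hg1 t)
  · exact ((hcont' z hz).measurable.mul hg).aestronglyMeasurable
  · filter_upwards [ae_restrict_mem measurableSet_Icc] with t ht w hw
    rw [norm_mul]
    exact (mul_le_of_le_one_right (norm_nonneg _) (hg1 t)).trans (hK _ ⟨(w, t), ⟨hw, ht⟩, rfl⟩)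
  · refine Eventually.of_forall fun t w hw => ?_
    have h1 : HasDerivAt F (deriv F (w + t * I)) (w + t * I) :=
      (hF.differentiableAt (hopen.mem_nhds (by simpa using hball w hw))).hasDerivAt
    exact (h1.comp_add_const w (t * I)).mul_const (g t)

open MeasureTheory in
/-- A three lines theorem for `L¹` norms on vertical lines. -/
theorem lintegral_three_lines {F : ℂ → ℂ} (hF : DifferentiableOn ℂ F {s | 0 < s.re}) {l r : ℝ}
    (hl : 0 < l) (hlr : l < r) {K : ℝ} (hK : ∀ s : ℂ, l ≤ s.re → s.re ≤ r → ‖F s‖ ≤ K)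
    {A B : ℝ} (hA0 : 0 ≤ A) (hB0 : 0 ≤ B)
    (hA : ∫⁻ t : ℝ, ‖F (l + t * I)‖ₑ ≤ ENNReal.ofReal A)
    (hB : ∫⁻ t : ℝ, ‖F (r + t * I)‖ₑ ≤ ENNReal.ofReal B) {x : ℝ} (hx : l ≤ x) (hx2 : x ≤ r) :
    ∫⁻ t : ℝ, ‖F (x + t * I)‖ₑ ≤
      ENNReal.ofReal (A ^ (1 - (x - l) / (r - l)) * B ^ ((x - l) / (r - l))) := by
  have hcont : ∀ w : ℂ, 0 < w.re → Continuous fun t : ℝ => F (w + t * I) := fun w hw =>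
    hF.continuousOn.comp_continuous (by fun_prop) fun t => by simpa using hw
  set g : ℝ → ℂ := fun t => (starRingEnd ℂ) (F (x + t * I)) / ‖F (x + t * I)‖ with hgdef
  have hcx := hcont x (by simpa using hl.trans_le hx)
  have hg : Measurable g := by
    apply Measurable.div
    · exact (Complex.continuous_conj.comp hcx).measurable
    · exact (Complex.continuous_ofReal.comp hcx.norm).measurable
  have hg1 : ∀ t, ‖g t‖ ≤ 1 := by
    intro t
    simp only [hgdef, norm_div, RCLike.norm_conj, Complex.norm_real, norm_norm]
    exact div_self_le_one _
  have hFg : ∀ t : ℝ, F (x + t * I) * g t = (‖F (x + t * I)‖ : ℂ) := by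
    intro t
    simp only [hgdef]
    rw [mul_div_assoc', Complex.mul_conj, Complex.normSq_eq_norm_sq]
    by_cases h0 : (‖F (x + t * I)‖ : ℂ) = 0
    · simp [h0]
    · field_simp
      push_cast
      ring
  have hline : ∀ (x : ℝ) (C : ℝ), 0 < x → 0 ≤ C → ∫⁻ t : ℝ, ‖F (x + t * I)‖ₑ ≤ ENNReal.ofReal C →
      ∀ Y : ℝ, ∀ z ∈ re ⁻¹' {x}, ‖∫ t in Set.Icc (-Y) Y, F (z + t * I) * g t‖ ≤ C := by
    intro x C hx hC0 hC Y z hz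
    have hz' : z.re = x := hz
    rw [← ENNReal.ofReal_le_ofReal_iff hC0, ofReal_norm]
    calc _ ≤ ∫⁻ t in Set.Icc (-Y) Y, ‖F (z + t * I) * g t‖ₑ := enorm_integral_le_lintegral_enorm _
      _ ≤ ∫⁻ t : ℝ, ‖F (z + t * I) * g t‖ₑ := setLIntegral_le_lintegral _ _
      _ ≤ ∫⁻ t : ℝ, ‖F (x + (z.im + t : ℝ) * I)‖ₑ := by
          apply lintegral_mono
          intro t
          dsimp only
          have : z + t * I = x + (z.im + t : ℝ) * I := by
            rw [← hz']
            conv_lhs => rw [← re_add_im z]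
            push_cast; ring
          rw [this, enorm_mul]
          refine mul_le_of_le_one_right' ?_
          rw [← ofReal_norm]
          exact ENNReal.ofReal_le_one.2 (hg1 t)
      _ = ∫⁻ t : ℝ, ‖F (x + t * I)‖ₑ :=
          lintegral_add_left_eq_self (fun t : ℝ => ‖F (x + t * I)‖ₑ) z.im
      _ ≤ _ := hC
  have hY : ∀ Y : ℝ, 0 ≤ Y → ∫⁻ t in Set.Icc (-Y) Y, ‖F (x + t * I)‖ₑ ≤
      ENNReal.ofReal (A ^ (1 - (x - l) / (r - l)) * B ^ ((x - l) / (r - l))) := by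
    intro Y hY0
    set Φ : ℂ → ℂ := fun z => ∫ t in Set.Icc (-Y) Y, F (z + t * I) * g t with hΦ
    have hpos : ∀ z : ℂ, l ≤ z.re → DifferentiableAt ℂ Φ z := fun z hz =>
      hasDerivAt_integral_translate hF hg hg1 Y (hl.trans_le hz)
    have hd : DiffContOnCl ℂ Φ (HadamardThreeLines.verticalStrip l r) := by
      apply DifferentiableOn.diffContOnCl
      intro z hz
      apply (hpos z _).differentiableWithinAt
      have hsub : closure (HadamardThreeLines.verticalStrip l r) ⊆ re ⁻¹' Set.Ici l :=
        closure_minimal (fun w hw => hw.1.le) (isClosed_Ici.preimage Complex.continuous_re)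
      exact hsub hz
    have hbdd : BddAbove ((norm ∘ Φ) '' HadamardThreeLines.verticalClosedStrip l r) := by
      refine ⟨K * (volume.real (Set.Icc (-Y) Y)), ?_⟩
      rintro _ ⟨z, hz, rfl⟩
      refine norm_setIntegral_le_of_norm_le_const (by simp) fun t ht => ?_
      rw [norm_mul]
      refine (mul_le_of_le_one_right (norm_nonneg _) (hg1 t)).trans (hK _ ?_ ?_)
      · simpa using hz.1
      · simpa using hz.2
    have key := HadamardThreeLines.norm_le_interp_of_mem_verticalClosedStrip' hlr (z := x)
      (by exact ⟨by simpa using hx, by simpa using hx2⟩) hd hbdd (hline l A hl hA0 hA Y)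
      (hline r B (hl.trans hlr) hB0 hB Y)
    have hreal : ‖Φ x‖ = ∫ t in Set.Icc (-Y) Y, ‖F (x + t * I)‖ := by
      simp only [hΦ, hFg]
      rw [integral_complex_ofReal, Complex.norm_real, Real.norm_of_nonneg]
      exact integral_nonneg fun t => norm_nonneg _
    rw [hreal, Complex.ofReal_re] at key
    have := ofReal_integral_eq_lintegral_ofReal (μ := volume.restrict (Set.Icc (-Y) Y))
      (f := fun t : ℝ => ‖F (x + t * I)‖) hcx.norm.continuousOn.integrableOn_Icc
      (Eventually.of_forall fun t => norm_nonneg _)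
    simp only [ofReal_norm] at this
    rw [← this]
    exact ENNReal.ofReal_le_ofReal key
  have hcov := aecover_Icc (μ := (volume : Measure ℝ)) (tendsto_neg_atTop_atBot.comp
    tendsto_natCast_atTop_atTop) (tendsto_natCast_atTop_atTop (R := ℝ))
  have := hcov.lintegral_tendsto_of_countably_generated (f := fun t : ℝ => ‖F (x + t * I)‖ₑ)
    hcx.enorm.measurable.aemeasurable
  exact le_of_tendsto' this fun n => hY n (Nat.cast_nonneg n)

open MeasureTheory in
theorem lintegral_mul_le_sqrt {f g : ℝ → ENNReal} (hf : AEMeasurable f) (hg : AEMeasurable g)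
    {A B : ℝ} (hA0 : 0 ≤ A) (hA : ∫⁻ t, f t ^ 2 ≤ ENNReal.ofReal A)
    (hB : ∫⁻ t, g t ^ 2 ≤ ENNReal.ofReal B) : ∫⁻ t, f t * g t ≤ ENNReal.ofReal √(A * B) := by
  have h := ENNReal.lintegral_mul_le_Lp_mul_Lq volume Real.HolderConjugate.two_two hf hg
  simp only [ENNReal.rpow_two, Pi.mul_apply] at h
  refine h.trans ?_
  rw [Real.sqrt_mul hA0, ENNReal.ofReal_mul (Real.sqrt_nonneg _)]
  have key : ∀ {C : ℝ} {a : ENNReal}, a ≤ ENNReal.ofReal C →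
      a ^ (1 / 2 : ℝ) ≤ ENNReal.ofReal √C := by
    intro C a ha
    rw [Real.sqrt_eq_rpow]
    rcases le_total 0 C with hC | hC
    · rw [← ENNReal.ofReal_rpow_of_nonneg hC (by norm_num)]
      gcongr
    · rw [ENNReal.ofReal_of_nonpos hC] at ha
      rw [le_zero_iff.1 ha, ENNReal.zero_rpow_of_pos (by norm_num)]
      exact bot_le
  exact mul_le_mul' (key hA) (key hB)

/-- `(ζ(s) M_X(s) - 1) (s - 1) / (s + 1)`, with the removable singularity at `1` removed. -/
noncomputable def mollifiedDefect (X : ℝ) (s : ℂ) : ℂ :=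
  (riemannZeta₁ s * MX X s - (s - 1)) / (s + 1)

theorem add_one_ne_zero_of_re_nonneg {s : ℂ} (hs : 0 ≤ s.re) : s + 1 ≠ 0 := by
  intro h
  have := congrArg Complex.re h
  simp at this
  linarith

theorem norm_sub_one_div_add_one_le {s : ℂ} (hs : 0 ≤ s.re) : ‖(s - 1) / (s + 1)‖ ≤ 1 := by
  rw [norm_div]
  refine div_le_one_of_le₀ ?_ (norm_nonneg _)
  rw [← sq_le_sq₀ (norm_nonneg _) (norm_nonneg _), ← Complex.normSq_eq_norm_sq,
    ← Complex.normSq_eq_norm_sq, Complex.normSq_apply, Complex.normSq_apply]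
  simp
  nlinarith

theorem norm_inv_add_one_le {s : ℂ} (hs : 0 ≤ s.re) : ‖(s + 1)⁻¹‖ ≤ 1 := by
  rw [norm_inv]
  refine inv_le_one_of_one_le₀ ?_
  have := Complex.re_le_norm (s + 1)
  simp at this
  linarith

theorem mollifiedDefect_eq (X : ℝ) {s : ℂ} (hs : s ≠ 1) :
    mollifiedDefect X s = fX X s * ((s - 1) / (s + 1)) := by
  have : s - 1 ≠ 0 := sub_ne_zero.2 hs
  rw [mollifiedDefect, fX, riemannZeta_eq_inv_sub_mul hs]
  field_simp

theorem differentiable_MX (X : ℝ) : Differentiable ℂ (MX X) := by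
  unfold MX
  apply Differentiable.fun_sum
  intro n hn
  apply Differentiable.const_mul
  have : (n : ℂ) ≠ 0 := by
    have := (Finset.mem_Icc.1 hn).1
    exact_mod_cast (by omega : n ≠ 0)
  intro s
  exact (differentiableAt_id.neg).const_cpow (Or.inl this)

theorem mollifiedDefect_differentiableAt (X : ℝ) {s : ℂ} (hs : s + 1 ≠ 0) :
    DifferentiableAt ℂ (mollifiedDefect X) s := by
  unfold mollifiedDefect
  have h1 := differentiable_riemannZeta₁ s
  have h2 := differentiable_MX X s
  fun_prop (disch := exact hs)

theorem norm_MX_le {X : ℝ} (hX : 0 ≤ X) {s : ℂ} (hs : 0 ≤ s.re) : ‖MX X s‖ ≤ X := by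
  unfold MX
  calc _ ≤ ∑ n ∈ Finset.Icc 1 ⌊X⌋₊, (1:ℝ) := by
        apply norm_sum_le_of_le
        intro n hn
        have hn1 := (Finset.mem_Icc.1 hn).1
        rw [norm_mul, Complex.norm_natCast_cpow_of_pos hn1]
        refine mul_le_one₀ (abs_moebius_cast_le_one n) (by positivity) ?_
        apply Real.rpow_le_one_of_one_le_of_nonpos
        · exact_mod_cast hn1
        · simpa using hs
    _ ≤ X := by simpa using Nat.floor_le hX

theorem norm_expKernel_le {h : ℝ} (hh : 0 < h) {s : ℂ} (hs : 1 / 2 ≤ s.re) (hs2 : s.re ≤ 3 / 2) :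
    ‖expKernel h s‖ ≤ (rexp (2 * h) + 1) * 2 := by
  unfold expKernel
  rw [div_eq_mul_inv, norm_mul, norm_inv]
  have h1 : 1 / 2 ≤ ‖s‖ := hs.trans (Complex.re_le_norm s)
  gcongr
  · refine (norm_sub_le _ _).trans ?_
    rw [Complex.norm_exp, norm_one]
    gcongr
    simp
    nlinarith
  · rw [inv_le_comm₀ (by linarith) (by norm_num)]
    linarith

theorem exists_norm_mollifiedDefect_mul_le {X h : ℝ} (hX : 0 ≤ X) (hh : 0 < h)
    (hh2 : rexp h ≤ 2) : ∃ K, ∀ s : ℂ, 1 / 2 ≤ s.re → s.re ≤ 3 / 2 →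
      ‖mollifiedDefect X s * expKernel h s ^ 2‖ ≤ K := by
  obtain ⟨D, hD⟩ := exists_norm_defectTransform_le hh hh2
  set C := (rexp (2 * h) + 1) * 2
  refine ⟨(D + 1) * X * C + C ^ 2, fun s hs hs2 => ?_⟩
  have hs0 : 0 ≤ s.re := by linarith
  have hC := norm_expKernel_le hh hs hs2
  have hC0 : 0 ≤ C := (norm_nonneg _).trans hC
  have hD0 : 0 ≤ D := (norm_nonneg _).trans (hD s hs hs2)
  have e : mollifiedDefect X s * expKernel h s ^ 2 =
      ((s - 1) / (s + 1) * defectTransform h s + (s + 1)⁻¹ * (rexp h - 1 : ℝ)) * MX X s *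
        expKernel h s - (s - 1) / (s + 1) * expKernel h s ^ 2 := by
    have h1 : mollifiedDefect X s * expKernel h s ^ 2 =
      (riemannZeta₁ s * expKernel h s) * (s + 1)⁻¹ * MX X s *
        expKernel h s - (s - 1) / (s + 1) * expKernel h s ^ 2 := by
      unfold mollifiedDefect; ring
    rw [h1, riemannZeta₁_mul_expKernel hh hh2 (by linarith)]
    push_cast
    ring
  rw [e]
  refine (norm_sub_le _ _).trans ?_
  rw [norm_mul, norm_mul, norm_mul, norm_pow]
  have hη : ‖((rexp h - 1 : ℝ) : ℂ)‖ ≤ 1 := by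
    rw [Complex.norm_real, Real.norm_of_nonneg] <;> linarith [Real.add_one_le_exp h]
  have hE := norm_sub_one_div_add_one_le hs0
  have hsum : ‖(s - 1) / (s + 1) * defectTransform h s + (s + 1)⁻¹ * (rexp h - 1 : ℝ)‖ ≤ D + 1 := by
    refine (norm_add_le _ _).trans ?_
    rw [norm_mul, norm_mul]
    apply add_le_add
    · calc _ ≤ 1 * D := by
            gcongr
            exact hD s hs hs2
        _ = D := one_mul D
    · exact mul_le_one₀ (norm_inv_add_one_le hs0) (norm_nonneg _) hη
  gcongr
  · exact norm_MX_le hX hs0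
  · calc _ ≤ 1 * C ^ 2 := by gcongr
      _ = C ^ 2 := one_mul _

theorem mollifiedDefect_mul_differentiableOn (X h : ℝ) :
    DifferentiableOn ℂ (fun s => mollifiedDefect X s * expKernel h s ^ 2) {s | 0 < s.re} := by
  intro s hs
  have hs' : 0 < s.re := hs
  have h0 : s ≠ 0 := by rintro rfl; simp at hs'
  exact ((mollifiedDefect_differentiableAt X (add_one_ne_zero_of_re_nonneg hs'.le)).mul
    ((expKernel_differentiableAt h h0).pow 2)).differentiableWithinAt

theorem continuous_vertical {F : ℂ → ℂ} {x : ℝ} (hF : ∀ t : ℝ, DifferentiableAt ℂ F (x + t * I)) :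
    Continuous fun t : ℝ => F (x + t * I) :=
  continuous_iff_continuousAt.2 fun t =>
    ContinuousAt.comp (f := fun t : ℝ => (x + t * I : ℂ)) (hF t).continuousAt (by fun_prop)

open MeasureTheory in
theorem lintegral_mollifiedDefect_mul_le_half {T : ℝ} (hT : 10 ^ 6 ≤ T)
    (hL : 27 ≤ Real.log T) : ∫⁻ t : ℝ, ‖mollifiedDefect (T / 2) ((1 / 2 : ℝ) + t * I) *
      expKernel (2 / T) ((1 / 2 : ℝ) + t * I) ^ 2‖ₑ ≤
    ENNReal.ofReal (7.2 * (2 / T) * Real.log T) := by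
  set h := 2 / T with hh
  have hT0 : 0 < T := by linarith
  have hh0 : 0 < h := by positivity
  have hXh : T / 2 = h⁻¹ := by rw [hh, inv_div]
  have hhle : h ≤ 1 / 10 ^ 5 := by
    rw [hh, div_le_div_iff₀ hT0 (by norm_num)]; linarith
  have hexp : rexp (2 * h) ≤ 1.001 := by
    have h1 := Real.add_one_le_exp (-(2 * h))
    rw [Real.exp_neg] at h1
    rw [← inv_inv (rexp (2 * h)), inv_le_comm₀ (by positivity) (by norm_num)]
    refine le_trans ?_ h1
    norm_num at hhle ⊢
    linarith
  have hexp1 : rexp h ≤ 1.001 := (Real.exp_le_exp.2 (by linarith)).trans hexp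
  have hlog : Real.log h⁻¹ ≤ Real.log T - 0.69 := by
    rw [← hXh, Real.log_div hT0.ne' (by norm_num)]
    linarith [Real.log_two_gt_d9]
  have hlog0 : 0 ≤ Real.log h⁻¹ := by
    apply Real.log_nonneg
    rw [← hXh]
    linarith
  have hXη : T / 2 * (rexp h - 1) ≤ 1.001 := by
    have h1 := Real.add_one_le_exp (-h)
    have h2 : rexp h * rexp (-h) = 1 := by rw [← Real.exp_add]; simp
    have h3 := Real.exp_pos h
    rw [hXh, inv_mul_le_iff₀ hh0]
    nlinarith
  have hη0 : 0 ≤ rexp h - 1 := by linarith [Real.add_one_le_exp h]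
  have hne : ∀ t : ℝ, ((1 / 2 : ℝ) + t * I : ℂ) ≠ 1 := by
    intro t h0
    have := congrArg Complex.re h0
    norm_num at this
  have hne0 : ∀ t : ℝ, ((1 / 2 : ℝ) + t * I : ℂ) ≠ 0 := by
    intro t h0
    have := congrArg Complex.re h0
    simp at this
  have hcK : Continuous fun t : ℝ => expKernel h ((1 / 2 : ℝ) + t * I) :=
    continuous_vertical fun t => expKernel_differentiableAt h (hne0 t)
  have hcM : Continuous fun t : ℝ => MX (T / 2) ((1 / 2 : ℝ) + t * I) :=
    continuous_vertical fun t => differentiable_MX _ _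
  have hcZ : Continuous fun t : ℝ => riemannZeta ((1 / 2 : ℝ) + t * I) :=
    continuous_vertical fun t => differentiableAt_riemannZeta (hne t)
  set A := 2 * π * (h * rexp h * (3 + h + Real.log h⁻¹)) with hA
  set B := 2 * π * h * rexp h * (1 + Real.log (T / 2) + T / 2 * (rexp h - 1)) with hB
  have hZ := lintegral_riemannZeta_mul_expKernel_le hh0 (by linarith : rexp h ≤ 2)
  have hM := lintegral_MX_mul_expKernel_le (X := T / 2) (h := h) (by linarith) hh0
  have hK := lintegral_expKernel_le (x := 1 / 2) (h := h) (by norm_num) hh0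
  have hA0 : 0 ≤ A := by positivity
  have hprod := lintegral_mul_le_sqrt (hcZ.mul hcK).enorm.measurable.aemeasurable
    (hcM.mul hcK).enorm.measurable.aemeasurable hA0 hZ hM
  calc _ ≤ ∫⁻ t : ℝ, (‖riemannZeta ((1 / 2 : ℝ) + t * I) * expKernel h ((1 / 2 : ℝ) + t * I)‖ₑ *
        ‖MX (T / 2) ((1 / 2 : ℝ) + t * I) * expKernel h ((1 / 2 : ℝ) + t * I)‖ₑ +
        ‖expKernel h ((1 / 2 : ℝ) + t * I)‖ₑ ^ 2) := by
        apply lintegral_mono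
        intro t
        dsimp only
        rw [mollifiedDefect_eq _ (hne t), fX]
        set s : ℂ := (1 / 2 : ℝ) + t * I
        simp only [← ofReal_norm]
        rw [← ENNReal.ofReal_mul (norm_nonneg _), ← ENNReal.ofReal_pow (norm_nonneg _),
          ← ENNReal.ofReal_add (by positivity) (by positivity)]
        apply ENNReal.ofReal_le_ofReal
        rw [norm_mul, norm_mul, norm_mul, norm_mul, norm_pow]
        have h1 : ‖riemannZeta s * MX (T / 2) s - 1‖ ≤
            ‖riemannZeta s‖ * ‖MX (T / 2) s‖ + 1 := by
          rw [← norm_mul]; simpa using norm_sub_le (riemannZeta s * MX (T / 2) s) 1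
        have h2 := norm_sub_one_div_add_one_le (s := s) (by simp [s])
        calc _ ≤ (‖riemannZeta s‖ * ‖MX (T / 2) s‖ + 1) * 1 * ‖expKernel h s‖ ^ 2 := by gcongr
          _ = _ := by ring
    _ = _ + _ := lintegral_add_right _ (hcK.enorm.measurable.pow_const 2)
    _ ≤ ENNReal.ofReal √(A * B) + ENNReal.ofReal (2 * π * h * rexp ((2 * (1 / 2) + 1) * h)) := by
        exact add_le_add hprod hK
    _ ≤ _ := by
        rw [← ENNReal.ofReal_add (by positivity) (by positivity)]
        apply ENNReal.ofReal_le_ofReal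
        set L := Real.log T
        have hA1 : A ≤ 2 * π * h * (1.001 * (L + 2.32)) := by
          rw [hA]
          have : h * rexp h * (3 + h + Real.log h⁻¹) ≤ h * (1.001 * (L + 2.32)) := by
            rw [mul_assoc]
            apply mul_le_mul_of_nonneg_left _ hh0.le
            apply mul_le_mul hexp1 _ (by positivity) (by norm_num)
            norm_num at hhle
            linarith
          nlinarith [Real.pi_pos]
        have hB00 : 0 ≤ 1 + Real.log (T / 2) + T / 2 * (rexp h - 1) := by
          have : 0 ≤ T / 2 * (rexp h - 1) := by positivity
          rw [hXh] at this ⊢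
          linarith
        have hB1 : B ≤ 2 * π * h * (1.001 * (L + 2.32)) := by
          rw [hB, mul_assoc _ (rexp h)]
          apply mul_le_mul_of_nonneg_left _ (by positivity)
          apply mul_le_mul hexp1 _ hB00 (by norm_num)
          rw [hXh] at hXη ⊢
          linarith
        have hB0 : 0 ≤ B := by positivity
        have hsq : √(A * B) ≤ 2 * π * h * (1.001 * (L + 2.32)) := by
          rw [Real.sqrt_le_left (by positivity)]
          nlinarith
        have h3 : rexp ((2 * (1 / 2) + 1) * h) ≤ 1.001 := by
          convert hexp using 2; ring
        calc √(A * B) + 2 * π * h * rexp ((2 * (1 / 2) + 1) * h) ≤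
            2 * π * h * (1.001 * (L + 2.32)) + 2 * π * h * 1.001 := by gcongr
          _ = h * (π * (2 * 1.001 * (L + 3.32))) := by ring
          _ ≤ h * (3.15 * (2 * 1.001 * (L + 3.32))) := by
              gcongr
              linarith [Real.pi_lt_d2]
          _ ≤ h * (7.2 * L) := by
              apply mul_le_mul_of_nonneg_left _ hh0.le
              norm_num
              linarith
          _ = _ := by ring

open MeasureTheory in
theorem lintegral_mollifiedDefect_mul_le_right {T : ℝ} (hT : 10 ^ 6 ≤ T)
    (hL : 27 ≤ Real.log T) {x : ℝ} (hx : 5 / 4 ≤ x) (hx2 : x ≤ 7 / 2) :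
    ∫⁻ t : ℝ, ‖mollifiedDefect (T / 2) (x + t * I) * expKernel (2 / T) (x + t * I) ^ 2‖ₑ ≤
    ENNReal.ofReal (7.2 * (2 / T) * Real.log T * T ^ (-(1 / 2) : ℝ)) := by
  set h := 2 / T with hh
  have hT0 : 0 < T := by linarith
  have hh0 : 0 < h := by positivity
  have hXh : 1 / (T / 2) = h := by rw [hh]; field_simp
  have hhle : h ≤ 1 / 10 ^ 5 := by
    rw [hh, div_le_div_iff₀ hT0 (by norm_num)]; linarith
  have hexp : rexp (8 * h) ≤ 1.001 := by
    have h1 := Real.add_one_le_exp (-(8 * h))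
    rw [Real.exp_neg] at h1
    rw [← inv_inv (rexp (8 * h)), inv_le_comm₀ (by positivity) (by norm_num)]
    refine le_trans ?_ h1
    norm_num at hhle ⊢
    linarith
  have hexp1 : rexp h ≤ 1.001 := (Real.exp_le_exp.2 (by linarith)).trans hexp
  have hη : rexp h - 1 ≤ 1.001 * h := by
    have h1 := Real.add_one_le_exp (-h)
    have h2 : rexp h * rexp (-h) = 1 := by rw [← Real.exp_add]; simp
    have h3 := Real.exp_pos h
    nlinarith
  have hη0 : 0 ≤ rexp h - 1 := by linarith [Real.add_one_le_exp h]
  have hne : ∀ t : ℝ, (x + t * I : ℂ) ≠ 1 := by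
    intro t h0
    have := congrArg Complex.re h0
    simp at this
    linarith
  have hne0 : ∀ t : ℝ, (x + t * I : ℂ) ≠ 0 := by
    intro t h0
    have := congrArg Complex.re h0
    simp at this
    linarith
  have hcK : Continuous fun t : ℝ => expKernel h (x + t * I) :=
    continuous_vertical fun t => expKernel_differentiableAt h (hne0 t)
  have hcF : Continuous fun t : ℝ => fX (T / 2) (x + t * I) :=
    continuous_vertical fun t =>
      ((differentiableAt_riemannZeta (hne t)).mul (differentiable_MX _ _)).sub_const 1
  have hF := lintegral_fX_mul_expKernel_le (X := T / 2) (h := h) (x := x) (by linarith) hh0 hx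
  have hK := lintegral_expKernel_le (x := x) (h := h) (by linarith) hh0
  have hprod := lintegral_mul_le_sqrt (hcF.mul hcK).enorm.measurable.aemeasurable
    hcK.enorm.measurable.aemeasurable (by positivity) hF hK
  calc _ ≤ ∫⁻ t : ℝ, (‖fX (T / 2) (x + t * I) * expKernel h (x + t * I)‖ₑ *
        ‖expKernel h (x + t * I)‖ₑ) := by
        apply lintegral_mono
        intro t
        dsimp only
        rw [mollifiedDefect_eq _ (hne t)]
        set s : ℂ := x + t * I
        simp only [← ofReal_norm]
        rw [← ENNReal.ofReal_mul (norm_nonneg _)]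
        apply ENNReal.ofReal_le_ofReal
        rw [norm_mul, norm_mul, norm_mul, norm_pow]
        have h2 := norm_sub_one_div_add_one_le (s := s) (by simp [s]; linarith)
        calc _ ≤ ‖fX (T / 2) s‖ * 1 * ‖expKernel h s‖ ^ 2 := by gcongr
          _ = _ := by ring
    _ ≤ _ := hprod
    _ ≤ _ := by
        apply ENNReal.ofReal_le_ofReal
        set L := Real.log T
        rw [Real.sqrt_le_left (by positivity)]
        have e1 : rexp (2 * x * h) ≤ 1.001 :=
          (Real.exp_le_exp.2 (by nlinarith)).trans hexp
        have e2 : rexp ((2 * x + 1) * h) ≤ 1.001 :=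
          (Real.exp_le_exp.2 (by nlinarith)).trans hexp
        have e3 : (T ^ (-(1 / 2) : ℝ)) ^ 2 = h / 2 := by
          rw [← Real.rpow_natCast, ← Real.rpow_mul hT0.le, hh]
          norm_num
          rw [Real.rpow_neg_one]
          field_simp
        have hpi : π ^ 2 ≤ 9.95 := by nlinarith [Real.pi_lt_d2, Real.pi_pos]
        rw [hXh]
        calc _ ≤ 2 * π * h * 1.001 * (81 * (h + 1.001 * h)) * (2 * π * h * 1.001) := by gcongr
          _ = π ^ 2 * (h ^ 3 * (4 * 1.001 ^ 2 * 81 * 2.001)) := by ring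
          _ ≤ 9.95 * (h ^ 3 * (4 * 1.001 ^ 2 * 81 * 2.001)) := by gcongr
          _ ≤ (7.2 ^ 2 * 27 ^ 2 / 2) * h ^ 3 := by
              have : 0 < h ^ 3 := by positivity
              norm_num
              nlinarith
          _ ≤ (7.2 ^ 2 * L ^ 2 / 2) * h ^ 3 := by gcongr
          _ = (7.2 * h * L) ^ 2 * (h / 2) := by ring
          _ = _ := by rw [mul_pow (7.2 * h * L), e3]

open MeasureTheory in
theorem lintegral_mollifiedDefect_mul_le {T : ℝ} (hT : 10 ^ 6 ≤ T)
    (hL : 27 ≤ Real.log T) {x : ℝ} (hx : 1 / 2 ≤ x) (hx2 : x ≤ 7 / 2) :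
    ∫⁻ t : ℝ, ‖mollifiedDefect (T / 2) (x + t * I) * expKernel (2 / T) (x + t * I) ^ 2‖ₑ ≤
    ENNReal.ofReal (7.2 * (2 / T) * Real.log T *
      (T ^ (-(2 / 3) * (x - 1 / 2)) + T ^ (-(1 / 2) : ℝ))) := by
  have hT0 : 0 < T := by linarith
  have hc : 0 < 7.2 * (2 / T) * Real.log T := by positivity
  have hp1 : 0 < T ^ (-(2 / 3) * (x - 1 / 2)) := by positivity
  have hp2 : 0 < T ^ (-(1 / 2) : ℝ) := by positivity
  rcases le_total (5 / 4) x with h | h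
  · refine (lintegral_mollifiedDefect_mul_le_right hT hL h hx2).trans
      (ENNReal.ofReal_le_ofReal ?_)
    gcongr
    linarith
  · have hexp : rexp (2 / T) ≤ 2 := by
      have h1 := Real.add_one_le_exp (-(2 / T))
      have h2 : 2 / T ≤ 1 / 2 := by rw [div_le_div_iff₀ hT0 (by norm_num)]; linarith
      rw [Real.exp_neg] at h1
      rw [← inv_inv (rexp _), inv_le_comm₀ (by positivity) (by norm_num)]
      linarith
    obtain ⟨K, hK⟩ := exists_norm_mollifiedDefect_mul_le (X := T / 2) (h := 2 / T)
      (by positivity) (by positivity) hexp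
    have := lintegral_three_lines (mollifiedDefect_mul_differentiableOn (T / 2) (2 / T))
      (l := 1 / 2) (r := 5 / 4) (by norm_num) (by norm_num)
      (fun s h1 h2 => hK s h1 (by linarith)) hc.le (by positivity)
      (lintegral_mollifiedDefect_mul_le_half hT hL)
      (lintegral_mollifiedDefect_mul_le_right hT hL (x := (5 / 4 : ℝ)) le_rfl (by norm_num)) hx h
    refine this.trans (ENNReal.ofReal_le_ofReal ?_)
    set y := (x - 1 / 2) / (5 / 4 - 1 / 2) with hy
    rw [Real.mul_rpow hc.le hp2.le, ← mul_assoc, ← Real.rpow_add hc, ← Real.rpow_mul hT0.le]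
    rw [show 1 - y + y = 1 by ring, Real.rpow_one,
      show (-(1 / 2) * y : ℝ) = -(2 / 3) * (x - 1 / 2) by rw [hy]; ring]
    gcongr
    linarith

theorem norm_exp_sub_one_sq (z : ℂ) :
    ‖cexp z - 1‖ ^ 2 = (rexp z.re - 1) ^ 2 + 4 * rexp z.re * Real.sin (z.im / 2) ^ 2 := by
  rw [← Complex.normSq_eq_norm_sq, Complex.normSq_apply, Complex.sub_re, Complex.sub_im,
    Complex.exp_re, Complex.exp_im, Complex.one_re, Complex.one_im]
  have h1 : Real.cos z.im = 1 - 2 * Real.sin (z.im / 2) ^ 2 := by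
    rw [show z.im = 2 * (z.im / 2) by ring, Real.cos_two_mul, Real.cos_sq',
      show 2 * (z.im / 2) / 2 = z.im / 2 by ring]
    ring
  have h2 := Real.sin_sq_add_cos_sq z.im
  linear_combination (rexp z.re) ^ 2 * h2 - 2 * rexp z.re * h1

theorem norm_exp_sub_one_sq_ge {z : ℂ} (hre : 0 ≤ z.re) (him : |z.im| ≤ 2.02) :
    0.66 * ‖z‖ ^ 2 ≤ ‖cexp z - 1‖ ^ 2 := by
  rw [norm_exp_sub_one_sq, ← Complex.normSq_eq_norm_sq, Complex.normSq_apply]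
  have h1 := Real.add_one_le_exp z.re
  have h2 : 0.66 * z.im ^ 2 ≤ 4 * Real.sin (z.im / 2) ^ 2 := by
    have h3 : Real.sin (z.im / 2) ^ 2 = Real.sin (|z.im| / 2) ^ 2 := by
      rcases abs_cases z.im with h | h
      · rw [h.1]
      · rw [h.1, neg_div, Real.sin_neg, neg_sq]
    rw [h3, ← sq_abs z.im]
    set b := |z.im|
    have hb : 0 ≤ b := abs_nonneg _
    have h4 := Real.sin_ge_sub_cube (x := b / 2) (by positivity)
    have h5 : 0.829 * (b / 2) ≤ Real.sin (b / 2) := by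
      refine le_trans ?_ h4
      have : b ^ 2 ≤ 4.0804 := by nlinarith
      nlinarith
    have h6 : (0.829 * (b / 2)) ^ 2 ≤ Real.sin (b / 2) ^ 2 :=
      pow_le_pow_left₀ (by positivity) h5 2
    nlinarith
  have h3 : 4 * Real.sin (z.im / 2) ^ 2 ≤ 4 * rexp z.re * Real.sin (z.im / 2) ^ 2 := by
    have := sq_nonneg (Real.sin (z.im / 2))
    nlinarith
  nlinarith

theorem norm_expKernel_sq_ge {h : ℝ} (hh : 0 ≤ h) {s : ℂ} (hs : 0 < s.re)
    (him : h * |s.im| ≤ 2.02) : 0.66 * h ^ 2 ≤ ‖expKernel h s‖ ^ 2 := by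
  have hs0 : s ≠ 0 := by rintro rfl; simp at hs
  have hn : 0 < ‖s‖ := norm_pos_iff.2 hs0
  have h1 := norm_exp_sub_one_sq_ge (z := (h : ℂ) * s) (by simp; positivity)
    (by simpa [abs_mul, abs_of_nonneg hh] using him)
  rw [expKernel, norm_div, div_pow, le_div_iff₀ (by positivity)]
  rw [norm_mul, Complex.norm_real, Real.norm_of_nonneg hh] at h1
  linarith

open MeasureTheory in
theorem setLIntegral_mollifiedDefect_le {T : ℝ} (hT : 10 ^ 6 ≤ T)
    (hL : 27 ≤ Real.log T) {x : ℝ} (hx : 1 / 2 ≤ x) (hx2 : x ≤ 7 / 2) :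
    ∫⁻ t in Set.Icc (-(T + 4)) (T + 4), ‖mollifiedDefect (T / 2) (x + t * I)‖ₑ ≤
    ENNReal.ofReal (5.5 * Real.log T * T *
      (T ^ (-(2 / 3) * (x - 1 / 2)) + T ^ (-(1 / 2) : ℝ))) := by
  have hT0 : 0 < T := by linarith
  have hc : 0 < 0.66 * (2 / T) ^ 2 := by positivity
  have key : ENNReal.ofReal (0.66 * (2 / T) ^ 2) *
      ∫⁻ t in Set.Icc (-(T + 4)) (T + 4), ‖mollifiedDefect (T / 2) (x + t * I)‖ₑ ≤
      ENNReal.ofReal (7.2 * (2 / T) * Real.log T *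
      (T ^ (-(2 / 3) * (x - 1 / 2)) + T ^ (-(1 / 2) : ℝ))) := by
    rw [← lintegral_const_mul' _ _ ENNReal.ofReal_ne_top]
    refine le_trans ?_ (lintegral_mollifiedDefect_mul_le hT hL hx hx2)
    refine le_trans (setLIntegral_mono' measurableSet_Icc (fun t ht => ?_))
      (setLIntegral_le_lintegral (Set.Icc (-(T + 4)) (T + 4)) _)
    have hb := norm_expKernel_sq_ge (h := 2 / T) (s := x + t * I) (by positivity)
      (by simp; linarith) (by
        have : |t| ≤ T + 4 := abs_le.2 ht
        have h8 : 8 / T ≤ 0.02 := by rw [div_le_iff₀ hT0]; linarith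
        calc 2 / T * |(x + t * I : ℂ).im| ≤ 2 / T * (T + 4) := by
              gcongr; simpa using this
          _ = 2 + 8 / T := by field_simp; ring
          _ ≤ _ := by linarith)
    simp only [← ofReal_norm]
    rw [← ENNReal.ofReal_mul hc.le, norm_mul, norm_pow, mul_comm ‖mollifiedDefect _ _‖]
    apply ENNReal.ofReal_le_ofReal
    gcongr
  rw [← ENNReal.mul_le_mul_iff_right (a := ENNReal.ofReal (0.66 * (2 / T) ^ 2))
    (by simpa using hc) ENNReal.ofReal_ne_top]
  refine key.trans ?_
  rw [← ENNReal.ofReal_mul hc.le]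
  apply ENNReal.ofReal_le_ofReal
  have hs : 0 < T ^ (-(2 / 3) * (x - 1 / 2)) + T ^ (-(1 / 2) : ℝ) := by positivity
  rw [← mul_assoc]
  refine mul_le_mul_of_nonneg_right ?_ hs.le
  have : 0.66 * (2 / T) ^ 2 * (5.5 * Real.log T * T) = (2 / T) * Real.log T * 7.26 := by
    field_simp
    norm_num
  have h2 : 0 < 2 / T * Real.log T := by positivity
  rw [this]
  nlinarith

theorem sum_log_add_log_norm_le_circleAverage {f : ℂ → ℂ} {c : ℂ} {R : ℝ} (hR : 0 < R)
    (hf : AnalyticOnNhd ℂ f (Metric.closedBall c R)) (hc : f c ≠ 0) (Z : Finset ℂ)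
    (hZ : ∀ z ∈ Z, ‖c - z‖ ≤ R) (hZ0 : ∀ z ∈ Z, f z = 0) :
    ∑ z ∈ Z, Real.log (R * ‖c - z‖⁻¹) + Real.log ‖f c‖ ≤
      circleAverage (Real.log ‖f ·‖) c R := by
  classical
  have hf' : AnalyticOnNhd ℂ f (Metric.closedBall c |R|) := by rwa [abs_of_pos hR]
  rw [hf'.circleAverage_log_norm hR.ne' hc, abs_of_pos hR]
  gcongr
  set D := MeromorphicOn.divisor f (Metric.closedBall c R) with hD
  have hfin := D.finiteSupport (isCompact_closedBall c R)
  have hlog : ∀ z, ‖c - z‖ ≤ R → 0 ≤ Real.log (R * ‖c - z‖⁻¹) := by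
    intro z hz
    rcases eq_or_ne ‖c - z‖ 0 with h | h
    · simp [h]
    · apply Real.log_nonneg
      have : 0 < ‖c - z‖ := lt_of_le_of_ne (norm_nonneg _) h.symm
      rw [← div_eq_mul_inv, one_le_div this]
      exact hz
  have hsupp : (Function.support fun u => (D u : ℝ) * Real.log (R * ‖c - u‖⁻¹)) ⊆
      ((hfin.toFinset ∪ Z : Finset ℂ) : Set ℂ) := by
    intro u hu
    have : D u ≠ 0 := by
      intro h
      simp [h] at hu
    simp [this]
  rw [finsum_eq_sum_of_support_subset _ hsupp]
  have hnn : ∀ u, 0 ≤ (D u : ℝ) * Real.log (R * ‖c - u‖⁻¹) := by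
    intro u
    by_cases hu : u ∈ Metric.closedBall c R
    · refine mul_nonneg ?_ (hlog u ?_)
      · exact_mod_cast MeromorphicOn.AnalyticOnNhd.divisor_nonneg hf u
      · rwa [mem_closedBall_iff_norm'] at hu
    · rw [hD, Function.locallyFinsuppWithin.apply_eq_zero_of_notMem _ hu]
      simp
  calc ∑ z ∈ Z, Real.log (R * ‖c - z‖⁻¹) ≤ ∑ z ∈ Z, (D z : ℝ) * Real.log (R * ‖c - z‖⁻¹) := by
        apply Finset.sum_le_sum
        intro z hz
        have hzb : z ∈ Metric.closedBall c R := by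
          rw [mem_closedBall_iff_norm']
          exact hZ z hz
        refine le_mul_of_one_le_left (hlog z (hZ z hz)) ?_
        have h1 : analyticOrderAt f z ≠ ⊤ := by
          refine hf.analyticOrderAt_ne_top_of_isPreconnected
            (convex_closedBall c R).isPreconnected (Metric.mem_closedBall_self hR.le) hzb ?_
          rw [(hf c (Metric.mem_closedBall_self hR.le)).analyticOrderAt_eq_zero.2 hc]
          simp
        have h2 : analyticOrderAt f z ≠ 0 := by
          rw [Ne, (hf z hzb).analyticOrderAt_eq_zero]
          simp [hZ0 z hz]
        rw [hD, MeromorphicOn.AnalyticOnNhd.divisor_apply hf hzb]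
        obtain ⟨n, hn⟩ := ENat.ne_top_iff_exists.1 h1
        rw [← hn] at h2 ⊢
        have h3 : n ≠ 0 := by exact_mod_cast h2
        rw [ENat.map_natCast, WithTop.untop₀_coe]
        exact_mod_cast Nat.one_le_iff_ne_zero.2 h3
    _ ≤ _ := Finset.sum_le_sum_of_subset_of_nonneg Finset.subset_union_right fun u _ _ => hnn u

theorem one_add_sq_le_exp {p : ℝ} (hp : 0 ≤ p) : 1 + p ^ 2 ≤ rexp p := by
  have h1 := Real.quadratic_le_exp_of_nonneg (x := p / 2) (by positivity)
  have h2 : rexp p = rexp (p / 2) ^ 2 := by rw [← Real.exp_nat_mul]; congr 1; push_cast; ring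
  rw [h2]
  have h3 : (1 + p / 2 + (p / 2) ^ 2 / 2) ^ 2 ≤ rexp (p / 2) ^ 2 :=
    pow_le_pow_left₀ (by positivity) h1 2
  refine le_trans ?_ h3
  nlinarith [sq_nonneg (p - 2), mul_nonneg hp (sq_nonneg (p - 2)), pow_nonneg hp 3, pow_nonneg hp 4]

/-- `((s - 1) / (s + 1))² - P(s)²` with `P` the mollified defect; it equals
`((s - 1) / (s + 1))² (1 - f_X(s)²)` and vanishes at the zeros of zeta. -/
noncomputable def zeroDetector (X : ℝ) (s : ℂ) : ℂ :=
  ((s - 1) / (s + 1)) ^ 2 - mollifiedDefect X s ^ 2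

theorem zeroDetector_eq_zero (X : ℝ) {s : ℂ} (hs : s ≠ 1) (hz : riemannZeta s = 0) :
    zeroDetector X s = 0 := by
  rw [zeroDetector, mollifiedDefect_eq X hs, fX, hz]
  ring

theorem zeroDetector_differentiableAt (X : ℝ) {s : ℂ} (hs : s + 1 ≠ 0) :
    DifferentiableAt ℂ (zeroDetector X) s := by
  unfold zeroDetector
  have h := mollifiedDefect_differentiableAt X hs
  fun_prop (disch := exact hs)

theorem log_norm_zeroDetector_le (X : ℝ) {s : ℂ} (hs : 0 ≤ s.re) :
    Real.log ‖zeroDetector X s‖ ≤ ‖mollifiedDefect X s‖ := by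
  rcases eq_or_ne ‖zeroDetector X s‖ 0 with h | h
  · rw [h, Real.log_zero]
    exact norm_nonneg _
  · have hpos : 0 < ‖zeroDetector X s‖ := lt_of_le_of_ne (norm_nonneg _) h.symm
    rw [Real.log_le_iff_le_exp hpos]
    refine le_trans ?_ (one_add_sq_le_exp (norm_nonneg _))
    refine (norm_sub_le _ _).trans ?_
    rw [norm_pow, norm_pow]
    gcongr
    exact pow_le_one₀ (norm_nonneg _) (norm_sub_one_div_add_one_le hs)

theorem sum_log_add_log_norm_zeroDetector_le {X R t : ℝ} (hR : 0 < R) (hR2 : R ≤ 3 / 2)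
    (hc : zeroDetector X (2 + t * I) ≠ 0) (Z : Finset ℂ)
    (hZ : ∀ z ∈ Z, ‖(2 + t * I) - z‖ ≤ R) (hZ1 : ∀ z ∈ Z, z ≠ 1)
    (hZ0 : ∀ z ∈ Z, riemannZeta z = 0) :
    ∑ z ∈ Z, Real.log (R * ‖(2 + t * I) - z‖⁻¹) + Real.log ‖zeroDetector X (2 + t * I)‖ ≤
      circleAverage (‖mollifiedDefect X ·‖) (2 + t * I) R := by
  have hre : ∀ s ∈ Metric.closedBall (2 + t * I) R, 0 ≤ s.re := by
    intro s hs
    rw [mem_closedBall_iff_norm'] at hs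
    have := (Complex.re_le_norm _).trans hs
    simp at this
    linarith
  have hopen : IsOpen {s : ℂ | s + 1 ≠ 0} := isOpen_ne_fun (by fun_prop) (by fun_prop)
  have han : AnalyticOnNhd ℂ (zeroDetector X) {s : ℂ | s + 1 ≠ 0} :=
    DifferentiableOn.analyticOnNhd
      (fun s hs => (zeroDetector_differentiableAt X hs).differentiableWithinAt) hopen
  have hanB := han.mono fun s hs => add_one_ne_zero_of_re_nonneg (hre s hs)
  refine (sum_log_add_log_norm_le_circleAverage hR hanB hc Z hZ
    fun z hz => zeroDetector_eq_zero X (hZ1 z hz) (hZ0 z hz)).trans ?_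
  have hsub : ∀ s ∈ Metric.sphere (2 + t * I : ℂ) |R|, 0 ≤ s.re := by
    rw [abs_of_pos hR]
    exact fun s hs => hre s (Metric.sphere_subset_closedBall hs)
  apply circleAverage_mono
  · apply MeromorphicOn.circleIntegrable_log_norm
    rw [abs_of_pos hR]
    exact (hanB.mono Metric.sphere_subset_closedBall).meromorphicOn
  · apply ContinuousOn.circleIntegrable hR.le
    rw [← abs_of_pos hR]
    intro s hs
    exact (mollifiedDefect_differentiableAt X
      (add_one_ne_zero_of_re_nonneg (hsub s hs))).continuousAt.norm.continuousWithinAt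
  · exact fun s hs => log_norm_zeroDetector_le X (hsub s hs)

theorem measurable_mollifiedDefect (X : ℝ) : Measurable (mollifiedDefect X) := by
  unfold mollifiedDefect
  have h1 := differentiable_riemannZeta₁.continuous.measurable
  have h2 := (differentiable_MX X).continuous.measurable
  fun_prop

open MeasureTheory in
theorem ofReal_circleAverage_mollifiedDefect {X R t : ℝ} (hR : 0 < R) (hR2 : R ≤ 3 / 2) :
    ENNReal.ofReal (circleAverage (‖mollifiedDefect X ·‖) (2 + t * I) R) =
      ENNReal.ofReal (2 * π)⁻¹ * ∫⁻ θ in Set.Ioc 0 (2 * π),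
        ‖mollifiedDefect X (circleMap (2 + t * I) R θ)‖ₑ := by
  have hci : CircleIntegrable (‖mollifiedDefect X ·‖) (2 + t * I) R := by
    apply ContinuousOn.circleIntegrable hR.le
    intro s hs
    rw [mem_sphere_iff_norm, norm_sub_rev] at hs
    have := (Complex.re_le_norm _).trans hs.le
    simp at this
    exact (mollifiedDefect_differentiableAt X
      (add_one_ne_zero_of_re_nonneg (by linarith))).continuousAt.norm.continuousWithinAt
  have hci' := (intervalIntegrable_iff_integrableOn_Ioc_of_le (by positivity)).1 hci
  rw [circleAverage, smul_eq_mul, ENNReal.ofReal_mul (by positivity),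
    intervalIntegral.integral_of_le (by positivity), ofReal_integral_eq_lintegral_ofReal hci'
    (Eventually.of_forall fun _ => norm_nonneg _)]
  simp only [ofReal_norm]

open MeasureTheory in
theorem lintegral_circleAverage_mollifiedDefect_le {T : ℝ} (hT : 10 ^ 6 ≤ T)
    (hL : 27 ≤ Real.log T) {R : ℝ} (hR : 0 < R) (hR2 : R ≤ 3 / 2) :
    ∫⁻ t in Set.Icc (-2) (T + 2),
      ENNReal.ofReal (circleAverage (‖mollifiedDefect (T / 2) ·‖) (2 + t * I) R) ≤
    ENNReal.ofReal (2 * π)⁻¹ * ∫⁻ θ in Set.Ioc 0 (2 * π), ENNReal.ofReal (5.5 * Real.log T * T *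
      (T ^ (-(2 / 3) * (2 + R * Real.cos θ - 1 / 2)) + T ^ (-(1 / 2) : ℝ))) := by
  simp only [ofReal_circleAverage_mollifiedDefect hR hR2]
  rw [lintegral_const_mul' _ _ ENNReal.ofReal_ne_top]
  gcongr ENNReal.ofReal (2 * π)⁻¹ * ?_
  rw [lintegral_lintegral_swap]
  swap
  · apply Measurable.aemeasurable
    apply Measurable.enorm
    apply (measurable_mollifiedDefect _).comp
    unfold circleMap
    fun_prop
  apply lintegral_mono
  intro θ
  dsimp only
  set x := 2 + R * Real.cos θ with hx
  have hcos := Real.abs_cos_le_one θ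
  have hsin := Real.abs_sin_le_one θ
  rw [abs_le] at hcos hsin
  have e : ∀ t : ℝ, circleMap (2 + t * I) R θ = x + (t + R * Real.sin θ : ℝ) * I := by
    intro t
    rw [circleMap, hx, Complex.exp_mul_I]
    push_cast
    ring
  simp only [e]
  refine le_trans ?_ (setLIntegral_mollifiedDefect_le hT hL (x := x) (by nlinarith) (by nlinarith))
  rw [← lintegral_indicator measurableSet_Icc, ← lintegral_indicator measurableSet_Icc,
    ← lintegral_add_right_eq_self (Set.indicator (Set.Icc (-(T + 4)) (T + 4)) _)
      (R * Real.sin θ)]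
  apply lintegral_mono
  intro t
  simp only [Set.indicator]
  split_ifs with h1 h2
  · exact le_rfl
  · refine absurd (Set.mem_Icc.2 ?_) h2
    have h1' := Set.mem_Icc.1 h1
    constructor <;> nlinarith [h1'.1, h1'.2, hsin.1, hsin.2]
  · exact zero_le
  · exact le_rfl

theorem one_add_cos_ge {θ : ℝ} (h0 : 0 ≤ θ) (h1 : θ ≤ 2 * π) :
    2 / π ^ 2 * (θ - π) ^ 2 ≤ 1 + Real.cos θ := by
  have h := Real.cos_le_one_sub_mul_cos_sq (x := θ - π) (abs_le.2 ⟨by linarith, by linarith⟩)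
  rw [Real.cos_sub_pi] at h
  linarith

open MeasureTheory in
theorem lintegral_gaussian_sub {b m : ℝ} (hb : 0 < b) :
    ∫⁻ θ : ℝ, ENNReal.ofReal (rexp (-b * (θ - m) ^ 2)) = ENNReal.ofReal √(π / b) := by
  rw [lintegral_sub_right_eq_self (fun θ => ENNReal.ofReal (rexp (-b * θ ^ 2))) m,
    ← integral_gaussian, ofReal_integral_eq_lintegral_ofReal (integrable_exp_neg_mul_sq hb)
    (Eventually.of_forall fun _ => (Real.exp_pos _).le)]

open MeasureTheory in
theorem lintegral_circleAverage_mollifiedDefect_le' {T : ℝ} (hT : 10 ^ 6 ≤ T)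
    (hL : 27 ≤ Real.log T) {R : ℝ} (hR : 4 / 3 ≤ R) (hR2 : R ≤ 3 / 2) :
    ∫⁻ t in Set.Icc (-2) (T + 2),
      ENNReal.ofReal (circleAverage (‖mollifiedDefect (T / 2) ·‖) (2 + t * I) R) ≤
    ENNReal.ofReal (5.5 * Real.log T * T *
      (0.67 / √(Real.log T) * T ^ (-(2 / 3) * (3 / 2 - R)) + T ^ (-(1 / 2) : ℝ))) := by
  refine (lintegral_circleAverage_mollifiedDefect_le hT hL (by linarith) hR2).trans ?_
  have hT0 : 0 < T := by linarith
  set L := Real.log T with hLd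
  have hL0 : 0 < L := by linarith
  set b := 16 * L / (9 * π ^ 2) with hb
  have hb0 : 0 < b := by positivity
  set A := T ^ (-(2 / 3) * (3 / 2 - R)) with hA
  set B := T ^ (-(1 / 2) : ℝ) with hB
  have hA0 : 0 < A := by positivity
  have hB0 : 0 < B := by positivity
  have hbound : ∀ θ ∈ Set.Ioc 0 (2 * π), ENNReal.ofReal (5.5 * L * T *
      (T ^ (-(2 / 3) * (2 + R * Real.cos θ - 1 / 2)) + B)) ≤
      ENNReal.ofReal (5.5 * L * T) * (ENNReal.ofReal A * ENNReal.ofReal (rexp (-b * (θ - π) ^ 2)) +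
        ENNReal.ofReal B) := by
    intro θ hθ
    rw [← ENNReal.ofReal_mul hA0.le, ← ENNReal.ofReal_add (by positivity) hB0.le,
      ← ENNReal.ofReal_mul (by positivity)]
    apply ENNReal.ofReal_le_ofReal
    gcongr
    rw [hA, Real.rpow_def_of_pos hT0, Real.rpow_def_of_pos hT0, ← Real.exp_add, ← hLd]
    apply Real.exp_le_exp.2
    have h1 := one_add_cos_ge hθ.1.le hθ.2
    have h2 : b * (θ - π) ^ 2 = L * (2 / 3) * (4 / 3) * (2 / π ^ 2 * (θ - π) ^ 2) := by
      rw [hb]; field_simp; ring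
    have h3 : L * (2 / 3) * (4 / 3) * (2 / π ^ 2 * (θ - π) ^ 2) ≤
        L * (2 / 3) * R * (1 + Real.cos θ) := by
      gcongr
    linarith
  calc _ ≤ ENNReal.ofReal (2 * π)⁻¹ * ∫⁻ θ in Set.Ioc 0 (2 * π), ENNReal.ofReal (5.5 * L * T) *
        (ENNReal.ofReal A * ENNReal.ofReal (rexp (-b * (θ - π) ^ 2)) + ENNReal.ofReal B) := by
        gcongr ENNReal.ofReal (2 * π)⁻¹ * ?_
        exact setLIntegral_mono' measurableSet_Ioc hbound
    _ = ENNReal.ofReal (2 * π)⁻¹ * (ENNReal.ofReal (5.5 * L * T) * (ENNReal.ofReal A *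
        (∫⁻ θ in Set.Ioc 0 (2 * π), ENNReal.ofReal (rexp (-b * (θ - π) ^ 2))) +
          ENNReal.ofReal B * ENNReal.ofReal (2 * π))) := by
        rw [lintegral_const_mul' _ _ ENNReal.ofReal_ne_top, lintegral_add_right _ measurable_const,
          lintegral_const_mul' _ _ ENNReal.ofReal_ne_top, setLIntegral_const, Real.volume_Ioc,
          sub_zero]
    _ ≤ ENNReal.ofReal (2 * π)⁻¹ * (ENNReal.ofReal (5.5 * L * T) * (ENNReal.ofReal A *
        ENNReal.ofReal √(π / b) + ENNReal.ofReal B * ENNReal.ofReal (2 * π))) := by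
        gcongr
        rw [← lintegral_gaussian_sub hb0 (m := π)]
        exact setLIntegral_le_lintegral _ _
    _ ≤ _ := by
        rw [← ENNReal.ofReal_mul hA0.le, ← ENNReal.ofReal_mul hB0.le,
          ← ENNReal.ofReal_add (by positivity) (by positivity),
          ← ENNReal.ofReal_mul (by positivity), ← ENNReal.ofReal_mul (by positivity)]
        apply ENNReal.ofReal_le_ofReal
        have e : (2 * π)⁻¹ * (5.5 * L * T * (A * √(π / b) + B * (2 * π))) =
            5.5 * L * T * ((2 * π)⁻¹ * √(π / b) * A + B) := by
          field_simp
        rw [e]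
        gcongr
        rw [inv_mul_le_iff₀ (by positivity), Real.sqrt_le_left (by positivity), mul_pow, div_pow,
          Real.sq_sqrt hL0.le, hb]
        rw [div_div_eq_mul_div, ← mul_div_assoc, div_le_div_iff₀ (by positivity) hL0]
        have := Real.pi_lt_d6
        have h0 := Real.pi_pos
        have : π * (9 * π ^ 2) ≤ (2 * π) ^ 2 * 0.67 ^ 2 * 16 := by
          have : 0 ≤ π ^ 2 * (4 * 0.67 ^ 2 * 16 - 9 * π) := by
            apply mul_nonneg (by positivity)
            norm_num; linarith
          linarith
        nlinarith

theorem neg_two_mul_le_log_one_sub {y : ℝ} (h0 : 0 ≤ y) (h1 : y ≤ 1 / 2) :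
    -(2 * y) ≤ Real.log (1 - y) := by
  refine le_trans ?_ (Real.one_sub_inv_le_log_of_pos (by linarith))
  have : (1 - y)⁻¹ ≤ 1 + 2 * y := by
    rw [inv_le_iff_one_le_mul₀ (by linarith)]
    nlinarith
  linarith

theorem zeroDetector_two_add {T : ℝ} (hT : 10 ^ 6 ≤ T) (t : ℝ) :
    zeroDetector (T / 2) (2 + t * I) ≠ 0 ∧
      -(8 * (1 + t ^ 2)⁻¹ + 26244 / T) ≤ Real.log ‖zeroDetector (T / 2) (2 + t * I)‖ := by
  have hT0 : 0 < T := by linarith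
  set s : ℂ := 2 + t * I with hs
  have hre : s.re = 2 := by simp [hs]
  have hs1 : s ≠ 1 := by
    intro h
    rw [h] at hre
    norm_num at hre
  have hf := norm_fX_le (X := T / 2) (by linarith) hre
  have hf2 : ‖fX (T / 2) s‖ ^ 2 ≤ 13122 / T := by
    calc _ ≤ (81 / √(T / 2)) ^ 2 := by gcongr
      _ = _ := by
        rw [div_pow, Real.sq_sqrt (by positivity)]
        field_simp
        norm_num
  have hsmall : 13122 / T ≤ 1 / 2 := by
    rw [div_le_div_iff₀ hT0 (by norm_num)]; linarith
  have hE : ‖((s - 1) / (s + 1)) ^ 2‖ = (1 + t ^ 2) / (9 + t ^ 2) := by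
    rw [norm_pow, norm_div, div_pow, ← Complex.normSq_eq_norm_sq, ← Complex.normSq_eq_norm_sq,
      Complex.normSq_apply, Complex.normSq_apply]
    simp [hs]
    ring
  have hEpos : 0 < (1 + t ^ 2) / (9 + t ^ 2) := by positivity
  have hH : zeroDetector (T / 2) s = ((s - 1) / (s + 1)) ^ 2 * (1 - fX (T / 2) s ^ 2) := by
    rw [zeroDetector, mollifiedDefect_eq _ hs1]
    ring
  have h1 : 1 - 13122 / T ≤ ‖1 - fX (T / 2) s ^ 2‖ := by
    have := norm_sub_norm_le (1 : ℂ) (fX (T / 2) s ^ 2)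
    rw [norm_one, norm_pow] at this
    linarith
  have h1pos : 0 < 1 - 13122 / T := by linarith
  have h2pos : 0 < ‖1 - fX (T / 2) s ^ 2‖ := h1pos.trans_le h1
  have hn : ‖zeroDetector (T / 2) s‖ = (1 + t ^ 2) / (9 + t ^ 2) * ‖1 - fX (T / 2) s ^ 2‖ := by
    rw [hH, norm_mul, hE]
  refine ⟨fun h => ?_, ?_⟩
  · rw [h, norm_zero] at hn
    exact (mul_pos hEpos h2pos).ne hn
  · rw [hn, Real.log_mul hEpos.ne' h2pos.ne']
    have h3 := Real.one_sub_inv_le_log_of_pos hEpos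
    have h4 := neg_two_mul_le_log_one_sub (y := 13122 / T) (by positivity) hsmall
    have h5 := Real.log_le_log h1pos h1
    have h6 : 1 - ((1 + t ^ 2) / (9 + t ^ 2))⁻¹ = -(8 * (1 + t ^ 2)⁻¹) := by
      have : 1 + t ^ 2 ≠ 0 := by positivity
      have : 9 + t ^ 2 ≠ 0 := by positivity
      field_simp
      ring
    rw [h6] at h3
    have h7 : 2 * (13122 / T) = 26244 / T := by ring
    linarith

theorem mul_le_log_div_norm {σ u t : ℝ} {ρ : ℂ} (hσl : 0.6 ≤ σ) (hσu : σ ≤ 2 / 3) (hu0 : 0 < u)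
    (hu : u ≤ 0.075) (hρ : σ < ρ.re) (hρ1 : ρ.re < 1) (ht : (t - ρ.im) ^ 2 ≤ u) :
    ‖(2 + t * I : ℂ) - ρ‖ ≤ 2 - σ + u ∧
      0.4 * u ≤ Real.log ((2 - σ + u) * ‖(2 + t * I : ℂ) - ρ‖⁻¹) := by
  set d := ‖(2 + t * I : ℂ) - ρ‖ with hd
  set R := 2 - σ + u with hR
  have hd2 : d ^ 2 = (2 - ρ.re) ^ 2 + (t - ρ.im) ^ 2 := by
    rw [hd, ← Complex.normSq_eq_norm_sq, Complex.normSq_apply]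
    simp
    ring
  have hd0 : 0 < d := by
    have : 0 < d ^ 2 := by rw [hd2]; nlinarith [sq_nonneg (t - ρ.im)]
    exact lt_of_le_of_ne (norm_nonneg _) fun h => by rw [← h] at this; norm_num at this
  have hR0 : 0 < R := by linarith
  have hle : d ^ 2 ≤ (R - u) ^ 2 + u := by
    rw [hd2]
    have : (2 - ρ.re) ^ 2 ≤ (R - u) ^ 2 := by
      apply pow_le_pow_left₀ <;> linarith
    linarith
  have hkey : d ^ 2 ≤ R ^ 2 * (1 - 0.8 * u) := by
    refine hle.trans ?_
    norm_num at hσl hu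
    have hRl : 4 / 3 ≤ R := by linarith
    have hRu : R ≤ 59 / 40 := by linarith
    have : 0 ≤ 2 * R - 1 - u - 0.8 * R ^ 2 := by
      norm_num
      nlinarith [mul_nonneg (sub_nonneg.2 hRl) (sub_nonneg.2 hRu)]
    have := mul_nonneg hu0.le this
    linarith
  refine ⟨?_, ?_⟩
  · rw [← sq_le_sq₀ hd0.le hR0.le]
    nlinarith [sq_nonneg R]
  · have h1 := Real.one_sub_inv_le_log_of_pos (x := (R * d⁻¹) ^ 2) (by positivity)
    rw [Real.log_pow] at h1
    have h2 : ((R * d⁻¹) ^ 2)⁻¹ ≤ 1 - 0.8 * u := by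
      rw [mul_pow, inv_pow, mul_inv, inv_inv, inv_mul_le_iff₀ (by positivity)]
      exact hkey
    push_cast at h1
    linarith

theorem re_lt_one_of_riemannZeta_eq_zero {ρ : ℂ} (h : riemannZeta ρ = 0) : ρ.re < 1 := by
  by_contra hc
  exact riemannZeta_ne_zero_of_one_le_re (not_lt.1 hc) h

open MeasureTheory in
theorem card_mul_le {σ T : ℝ} (hσl : 0.6 ≤ σ) (hσu : σ ≤ 2 / 3) (hT : 10 ^ 6 ≤ T)
    (hL : 27 ≤ Real.log T) {u : ℝ} (hu0 : 0 < u) (hu : u ≤ 0.075) (Z : Finset ℂ)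
    (hZ : ∀ ρ ∈ Z, riemannZeta ρ = 0 ∧ σ < ρ.re ∧ 0 < ρ.im ∧ ρ.im ≤ T) :
    (Z.card : ℝ) * (0.4 * u * (2 * √u)) ≤ 5.5 * Real.log T * T *
      (0.67 / √(Real.log T) * T ^ (-(2 / 3) * (σ - u - 1 / 2)) + T ^ (-(1 / 2) : ℝ)) + 26300 := by
  classical
  have hT0 : 0 < T := by linarith
  have hsu : √u ≤ 1 := by
    rw [Real.sqrt_le_left zero_le_one]; norm_num at hu ⊢; linarith
  set R := 2 - σ + u with hR
  have hpt : ∀ t : ℝ, ∑ ρ ∈ Z, (Set.Icc (ρ.im - √u) (ρ.im + √u)).indicator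
      (fun _ => ENNReal.ofReal (0.4 * u)) t ≤
      ENNReal.ofReal (circleAverage (‖mollifiedDefect (T / 2) ·‖) (2 + t * I) R) +
        ENNReal.ofReal (8 * (1 + t ^ 2)⁻¹ + 26244 / T) := by
    intro t
    set W := Z.filter fun ρ => t ∈ Set.Icc (ρ.im - √u) (ρ.im + √u) with hW
    have hlocal : ∀ ρ ∈ W, ‖(2 + t * I : ℂ) - ρ‖ ≤ R ∧
        0.4 * u ≤ Real.log (R * ‖(2 + t * I : ℂ) - ρ‖⁻¹) := by
      intro ρ hρ
      obtain ⟨hρZ, hρt⟩ := Finset.mem_filter.1 hρ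
      obtain ⟨h1, h2, -, -⟩ := hZ ρ hρZ
      refine mul_le_log_div_norm hσl hσu hu0 hu h2 (re_lt_one_of_riemannZeta_eq_zero h1) ?_
      rw [← Real.sq_sqrt hu0.le, sq_le_sq, abs_of_nonneg (Real.sqrt_nonneg u), abs_le]
      constructor <;> linarith [hρt.1, hρt.2]
    obtain ⟨hne, hlog⟩ := zeroDetector_two_add hT t
    have hjensen := sum_log_add_log_norm_zeroDetector_le (X := T / 2) (R := R) (t := t)
      (by linarith) (by norm_num at hσl hu; linarith) hne W (fun ρ hρ => (hlocal ρ hρ).1)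
      (fun ρ hρ h => by
        have := re_lt_one_of_riemannZeta_eq_zero (hZ ρ (Finset.mem_filter.1 hρ).1).1
        rw [h, Complex.one_re] at this
        exact lt_irrefl _ this)
      (fun ρ hρ => (hZ ρ (Finset.mem_filter.1 hρ).1).1)
    have hsum := Finset.sum_le_sum fun ρ hρ => (hlocal ρ hρ).2
    calc _ = ∑ ρ ∈ W, ENNReal.ofReal (0.4 * u) := by
          simp only [hW, Finset.sum_filter, Set.indicator]
      _ = ENNReal.ofReal (∑ ρ ∈ W, 0.4 * u) := by
          rw [ENNReal.ofReal_sum_of_nonneg]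
          intros; positivity
      _ ≤ ENNReal.ofReal (circleAverage (‖mollifiedDefect (T / 2) ·‖) (2 + t * I) R +
          (8 * (1 + t ^ 2)⁻¹ + 26244 / T)) := by
          apply ENNReal.ofReal_le_ofReal
          linarith
      _ ≤ _ := ENNReal.ofReal_add_le
  have hInt := lintegral_mono (μ := volume.restrict (Set.Icc (-2) (T + 2))) hpt
  rw [lintegral_add_right _ (by fun_prop), lintegral_finsetSum _ (fun ρ _ =>
    measurable_const.indicator measurableSet_Icc)] at hInt
  have hleft : ∀ ρ ∈ Z, ∫⁻ t in Set.Icc (-2) (T + 2), (Set.Icc (ρ.im - √u) (ρ.im + √u)).indicator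
      (fun _ => ENNReal.ofReal (0.4 * u)) t = ENNReal.ofReal (0.4 * u * (2 * √u)) := by
    intro ρ hρ
    obtain ⟨-, -, h3, h4⟩ := hZ ρ hρ
    rw [lintegral_indicator_const measurableSet_Icc, Measure.restrict_apply measurableSet_Icc,
      Set.inter_eq_left.2 (Set.Icc_subset_Icc (by linarith) (by linarith)), Real.volume_Icc,
      ← ENNReal.ofReal_mul (by positivity)]
    congr 2
    ring
  rw [Finset.sum_congr rfl hleft, Finset.sum_const, nsmul_eq_mul] at hInt
  have hmid := lintegral_circleAverage_mollifiedDefect_le' hT hL (R := R) (by linarith)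
    (by norm_num at hσl hu; linarith)
  have hright : ∫⁻ t in Set.Icc (-2) (T + 2), ENNReal.ofReal (8 * (1 + t ^ 2)⁻¹ + 26244 / T) ≤
      ENNReal.ofReal 26300 := by
    calc _ ≤ ∫⁻ t in Set.Icc (-2) (T + 2), (ENNReal.ofReal (8 * (1 + t ^ 2)⁻¹) +
          ENNReal.ofReal (26244 / T)) := lintegral_mono fun t => ENNReal.ofReal_add_le
      _ = (∫⁻ t in Set.Icc (-2) (T + 2), ENNReal.ofReal (8 * (1 + t ^ 2)⁻¹)) +
          ENNReal.ofReal (26244 / T) * ENNReal.ofReal (T + 2 - -2) := by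
          rw [lintegral_add_right _ measurable_const, setLIntegral_const, Real.volume_Icc]
      _ ≤ ENNReal.ofReal (8 * π) + ENNReal.ofReal (26244 / T) * ENNReal.ofReal (T + 2 - -2) := by
          gcongr
          refine (setLIntegral_le_lintegral _ _).trans_eq ?_
          rw [← integral_univ_inv_one_add_sq, ← integral_const_mul,
            ofReal_integral_eq_lintegral_ofReal (integrable_inv_one_add_sq.const_mul 8)
            (Eventually.of_forall fun t => by positivity)]
      _ ≤ _ := by
          rw [← ENNReal.ofReal_mul (by positivity), ← ENNReal.ofReal_add (by positivity)
            (by have : 0 ≤ T + 2 - -2 := by linarith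
                positivity)]
          apply ENNReal.ofReal_le_ofReal
          have h1 : 26244 / T * (T + 2 - -2) = 26244 + 104976 / T := by field_simp; ring
          have h2 : 104976 / T ≤ 1 := by rw [div_le_one hT0]; linarith
          linarith [Real.pi_lt_d2]
  have htot := hInt.trans (add_le_add hmid hright)
  have hLpos : 0 < Real.log T := by linarith
  rw [← ENNReal.ofReal_add (by positivity) (by norm_num), ← ENNReal.ofReal_natCast,
    ← ENNReal.ofReal_mul (by positivity), ENNReal.ofReal_le_ofReal_iff (by positivity)] at htot
  convert htot using 6
  rw [hR]
  ring

theorem m0_ge : 1.3 ≤ m0 := by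
  unfold m0
  apply Real.le_sqrt_of_sq_le
  have : (1.09 : ℝ) ≤ √(6 / 5) := Real.le_sqrt_of_sq_le (by norm_num)
  norm_num at this ⊢
  linarith

theorem Cconst_rpow_mul_ge {v L σ T₀ : ℝ} (hσ : 0 ≤ σ) (hv : 0 < v) (hvσ : 2 * σ - 1 = v)
    (hT₀ : 0 < T₀) (hLd : Real.log T₀ = L) (hL : 0 < L) :
    3 * σ / (2 * L) ≤ v ^ 3 * Cconst σ (T₀ ^ v) := by
  have hlog : Real.log (T₀ ^ v) = v * L := by rw [Real.log_rpow hT₀, hLd]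
  have h1 : 3 * v ^ 2 / (v * L) ≤ v ^ 3 + 3 * v ^ 2 / (v * L) + 6 * v / (v * L) ^ 2 +
      6 / (v * L) ^ 3 := by
    have : 0 ≤ v ^ 3 := by positivity
    have : 0 ≤ 6 * v / (v * L) ^ 2 := by positivity
    have : 0 ≤ 6 / (v * L) ^ 3 := by positivity
    linarith
  unfold Cconst
  rw [hvσ, hlog]
  calc 3 * σ / (2 * L) = v ^ 3 * (σ / (2 * v ^ 4) * (3 * v ^ 2 / (v * L))) := by
        field_simp
    _ ≤ _ := by gcongr

theorem C1_ge {σ T₀ : ℝ} (hσl : 0.6 ≤ σ) (hσu : σ ≤ 2 / 3) (hT₀ : 1 ≤ T₀)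
    (hL : 1 ≤ Real.log T₀) : 4.27 / Real.log T₀ ≤ C1 σ T₀ := by
  have hm := m0_ge
  norm_num at hσl hm
  have hT0 : 0 < T₀ := by linarith
  set L := Real.log T₀ with hLd
  have hL0 : 0 < L := by linarith
  set q := Real.log L / L with hq
  have hq0 : 0 ≤ q := div_nonneg (Real.log_nonneg hL) hL0.le
  set v := 2 * σ - 1 with hv
  have hv0 : 0 < v := by linarith
  have hc := Cconst_rpow_mul_ge (by linarith) hv0 hv.symm hT0 hLd.symm hL0
  have hcpos : 0 ≤ Cconst σ (T₀ ^ v) := by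
    by_contra hneg
    have h1 : 0 < 3 * σ / (2 * L) := by positivity
    have h2 : v ^ 3 * Cconst σ (T₀ ^ v) ≤ 0 :=
      mul_nonpos_of_nonneg_of_nonpos (by positivity) (not_le.1 hneg).le
    linarith
  have hK : 0.3125 ≤ KMVinf σ := by
    unfold KMVinf
    have : 0.0625 ≤ (2 * σ - 1) / (8 * (1 - σ)) := by
      rw [le_div_iff₀ (by linarith)]; norm_num; linarith
    norm_num at this ⊢
    linarith
  have hfirst : 0.612 / L ≤ 1.36 * (0.5 + 2 * π * m0 / T₀) * (v + q) ^ 3 * Cconst σ (T₀ ^ v) := by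
    have h1 : 0 ≤ 2 * π * m0 / T₀ := by
      have := Real.pi_pos
      positivity
    calc 0.612 / L ≤ 0.68 * (3 * σ / (2 * L)) := by
          rw [← mul_div_assoc, div_le_div_iff₀ hL0 (by positivity)]
          nlinarith
      _ ≤ 0.68 * (v ^ 3 * Cconst σ (T₀ ^ v)) := by gcongr
      _ = 1.36 * (0.5 + 0) * (v + 0) ^ 3 * Cconst σ (T₀ ^ v) := by ring
      _ ≤ _ := by gcongr
  have hsecond : 3.67 / L ≤ 2 * π * m0 * (KMVinf σ / L) * (2 * σ + q) ^ 2 := by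
    calc 3.67 / L ≤ 2 * 3.14 * 1.3 * (0.3125 / L) * (2 * (3 / 5) + 0) ^ 2 := by
          rw [← mul_div_assoc, div_mul_eq_mul_div]
          gcongr
          norm_num
      _ ≤ _ := by
          have := Real.pi_gt_d2
          have hm' : (1.3 : ℝ) ≤ m0 := m0_ge
          gcongr
  unfold C1
  rw [← hLd, ← hq, ← hv]
  have e : 4.27 / L ≤ 0.612 / L + 3.67 / L := by
    rw [← add_div]
    gcongr
    norm_num
  linarith

theorem Kconst_ge {σ T₀ : ℝ} (hσl : 0.6 ≤ σ) (hσu : σ ≤ 2 / 3) (hT₀ : 1 ≤ T₀)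
    (hL : 1 ≤ Real.log T₀) : 2.7 / Real.log T₀ ≤ Kconst σ T₀ := by
  have hC1 := C1_ge hσl hσu hT₀ hL
  norm_num at hσl
  set L := Real.log T₀ with hLd
  have hL0 : 0 < L := by linarith
  have hpow : (2 : ℝ) ^ (1 - 2 * σ) ≤ 1 :=
    Real.rpow_le_one_of_one_le_of_nonpos (by norm_num) (by linarith)
  have hC2 : 2 * C1 σ T₀ ≤ C2 σ T₀ := by
    unfold C2
    have h1 : 0 < 2 * σ - 1 := by linarith
    have h2 : 0 ≤ 1 - (2 : ℝ) ^ (1 - 2 * σ) := by linarith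
    have : 0 ≤ 166.34 / (2 * σ - 1) * (1 - (2 : ℝ) ^ (1 - 2 * σ)) / (T₀ * Real.log T₀ ^ 3) := by
      rw [← hLd]
      positivity
    linarith
  have hp0 : 0 < 4 * σ * (1 - σ) := by nlinarith
  have hp1 : 4 * σ * (1 - σ) ≤ 1 := by nlinarith [sq_nonneg (2 * σ - 1)]
  have h1 : (0.5 : ℝ) ^ (4 * σ * (1 - σ)) < 1 :=
    Real.rpow_lt_one (by norm_num) (by norm_num) hp0
  have h2 : (0.5 : ℝ) ≤ (0.5 : ℝ) ^ (4 * σ * (1 - σ)) := by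
    conv_lhs => rw [← Real.rpow_one (0.5 : ℝ)]
    exact Real.rpow_le_rpow_of_exponent_ge (by norm_num) (by norm_num) hp1
  have hC10 : 0 < C1 σ T₀ := lt_of_lt_of_le (by positivity) hC1
  have hC3 : 4 * C1 σ T₀ ≤ C3 σ T₀ := by
    unfold C3
    rw [le_div_iff₀ (by linarith)]
    norm_num at h1 h2 ⊢
    nlinarith
  unfold Kconst
  rw [← hLd]
  have h3 : 0 ≤ 0.004 * (1.25 - σ + 1 / L) := by
    have : 0 < L⁻¹ := by positivity
    norm_num
    linarith
  have h4 : 0 ≤ 0.05 / (4 * π * L ^ 2) := by positivity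
  have h5 : 2.7 / L ≤ C3 σ T₀ / (2 * π) := by
    have hpi := Real.pi_lt_d2
    rw [le_div_iff₀ (by positivity)]
    calc 2.7 / L * (2 * π) ≤ 2.7 / L * (2 * 3.15) := by gcongr
      _ ≤ 4 * (4.27 / L) := by
          rw [div_mul_eq_mul_div, ← mul_div_assoc]
          refine div_le_div_of_nonneg_right ?_ hL0.le
          norm_num
      _ ≤ _ := by linarith
  linarith

theorem finite_riemannZeta_zeros {σ T : ℝ} :
    {ρ : ℂ | riemannZeta ρ = 0 ∧ σ < ρ.re ∧ 0 < ρ.im ∧ ρ.im ≤ T}.Finite := by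
  refine ((isCompact_Icc (a := σ) (b := 1)).reProdIm
    (isCompact_Icc (a := (0 : ℝ)) (b := T))).inter_riemannZetaZeros_finite.subset ?_
  rintro ρ ⟨h1, h2, h3, h4⟩
  exact ⟨⟨⟨h2.le, (re_lt_one_of_riemannZeta_eq_zero h1).le⟩, h3.le, h4⟩, h1⟩

theorem twenty_seven_le_log {T : ℝ} (hT : 3 * 10 ^ 12 ≤ T) : 27 ≤ Real.log T := by
  rw [Real.le_log_iff_exp_le (by linarith)]
  refine le_trans ?_ hT
  have h := Real.exp_one_lt_d9
  have h2 : rexp 27 = rexp 1 ^ 27 := by rw [← Real.exp_nat_mul]; norm_num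
  rw [h2]
  calc rexp 1 ^ 27 ≤ 2.7182818286 ^ 27 := pow_le_pow_left₀ (Real.exp_pos 1).le h.le 27
    _ ≤ _ := by norm_num

theorem exp_four_thirds_le : rexp (4 / 3) ≤ 3.8 := by
  have h := Real.exp_one_lt_d9
  have h3 : rexp (4 / 3) ^ 3 = rexp 1 ^ 4 := by
    rw [← Real.exp_nat_mul, ← Real.exp_nat_mul]; norm_num
  by_contra hlt
  have h4 : (3.8 : ℝ) ^ 3 < rexp (4 / 3) ^ 3 :=
    pow_lt_pow_left₀ (not_le.1 hlt) (by norm_num) (by norm_num)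
  have h5 : rexp 1 ^ 4 ≤ 2.7182818286 ^ 4 := pow_le_pow_left₀ (Real.exp_pos 1).le h.le 4
  rw [h3] at h4
  norm_num at h4 h5
  linarith

theorem mul_rpow_le_of_zero_density {σ T : ℝ} (hσl : 3 / 5 ≤ σ) (hσu : σ ≤ 2 / 3) (hT : 1 < T) :
    T * T ^ (-(2 / 3) * (σ - 2 / Real.log T - 1 / 2)) ≤ 3.8 * T ^ (4 * σ * (1 - σ)) := by
  have hT0 : 0 < T := by linarith
  have hL0 : 0 < Real.log T := Real.log_pos hT
  set L := Real.log T with hLd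
  have e : T * T ^ (-(2 / 3) * (σ - 2 / L - 1 / 2)) =
      rexp (4 / 3) * T ^ (1 - 2 / 3 * (σ - 1 / 2)) := by
    conv_lhs => enter [1]; rw [← Real.rpow_one T]
    rw [← Real.rpow_add hT0, Real.rpow_def_of_pos hT0, Real.rpow_def_of_pos hT0, ← Real.exp_add,
      ← hLd]
    congr 1
    field_simp
    ring
  rw [e]
  refine mul_le_mul exp_four_thirds_le ?_ (by positivity) (by norm_num)
  exact Real.rpow_le_rpow_of_exponent_le (by linarith) (by nlinarith)

theorem Nzeros_le {σ T : ℝ} (hσl : 0.6 ≤ σ) (hσu : σ ≤ 2 / 3) (hT : 3 * 10 ^ 12 ≤ T) :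
    (Nzeros σ T : ℝ) ≤ 10 * Real.log T ^ 2 * T ^ (4 * σ * (1 - σ)) := by
  have hL := twenty_seven_le_log hT
  set Z := (finite_riemannZeta_zeros (σ := σ) (T := T)).toFinset with hZ
  have hN : Nzeros σ T = Z.card := by
    rw [Nzeros, Nat.card_coe_set_eq, Set.ncard_eq_toFinset_card _ finite_riemannZeta_zeros]
  have hT0 : 0 < T := by linarith
  have hu : 2 / Real.log T ≤ 0.075 := by
    rw [div_le_iff₀ (by linarith)]; norm_num; linarith
  have hmain := card_mul_le hσl hσu (by linarith) hL (u := 2 / Real.log T) (by positivity) hu Z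
    (fun ρ hρ => by simpa [hZ] using hρ)
  norm_num at hσl
  rw [hN]
  set n : ℝ := (Z.card : ℝ) with hn
  have hn0 : 0 ≤ n := Nat.cast_nonneg _
  set L := Real.log T with hLd
  have hL0 : 0 < L := by linarith
  set r := √L with hr
  have hr2 : r ^ 2 = L := Real.sq_sqrt hL0.le
  have hr0 : 0 < r := Real.sqrt_pos.2 hL0
  have hr1 : 1 ≤ r := by nlinarith
  set M := T ^ (4 * σ * (1 - σ)) with hM
  have hM0 : 0 < M := by positivity
  set y := T ^ (1 / 4 : ℝ) with hy
  have hy4 : y ^ 4 = T := by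
    rw [hy, ← Real.rpow_natCast, ← Real.rpow_mul hT0.le]; norm_num
  have hy0 : 0 < y := by positivity
  have hy1 : 1000 ≤ y := by
    by_contra hlt
    have : y ^ 4 < 1000 ^ 4 := pow_lt_pow_left₀ (not_le.1 hlt) hy0.le (by norm_num)
    rw [hy4] at this
    norm_num at this
    linarith
  have hLy : L ≤ y ^ 2 := by
    have := Real.log_le_rpow_div hT0.le (ε := 1 / 4) (by norm_num)
    rw [← hLd, ← hy] at this
    nlinarith
  have hry : r ≤ y := by
    rw [hr]
    exact Real.sqrt_le_iff.2 ⟨hy0.le, hLy⟩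
  have hMy : y ^ 3 ≤ M := by
    rw [hy, ← Real.rpow_natCast, ← Real.rpow_mul hT0.le, hM]
    apply Real.rpow_le_rpow_of_exponent_le (by linarith)
    push_cast
    nlinarith
  have hsqrtT : T * T ^ (-(1 / 2) : ℝ) = y ^ 2 := by
    conv_lhs => enter [1]; rw [← Real.rpow_one T]
    rw [← Real.rpow_add hT0, hy, ← Real.rpow_natCast, ← Real.rpow_mul hT0.le]
    norm_num
  have hTM := mul_rpow_le_of_zero_density hσl hσu (by linarith : 1 < T)
  rw [← hLd, ← hM] at hTM
  have hsqrt : 1.41 / r ≤ √(2 / L) := by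
    rw [Real.sqrt_div (by norm_num), ← hr]
    gcongr
    exact Real.le_sqrt_of_sq_le (by norm_num)
  have hlow : n * (2.25 / (L * r)) ≤ n * (0.4 * (2 / L) * (2 * √(2 / L))) := by
    gcongr
    calc 2.25 / (L * r) ≤ 0.4 * (2 / L) * (2 * (1.41 / r)) := by
          have : 0.4 * (2 / L) * (2 * (1.41 / r)) = 2.256 / (L * r) := by
            field_simp; norm_num
          rw [this]
          gcongr
          norm_num
      _ ≤ _ := by gcongr
  have hup : 5.5 * L * T * (0.67 / r * T ^ (-(2 / 3) * (σ - 2 / L - 1 / 2)) +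
      T ^ (-(1 / 2) : ℝ)) + 26300 ≤ 5.5 * L * (0.67 / r * (3.8 * M) + y ^ 2) + 26300 := by
    calc _ = 5.5 * L * (0.67 / r * (T * T ^ (-(2 / 3) * (σ - 2 / L - 1 / 2))) +
          T * T ^ (-(1 / 2) : ℝ)) + 26300 := by ring
      _ ≤ _ := by
          rw [hsqrtT]
          gcongr
  have hfin := (hlow.trans hmain).trans hup
  rw [← mul_div_assoc, div_le_iff₀ (by positivity)] at hfin
  have e2 : (5.5 * L * (0.67 / r * (3.8 * M) + y ^ 2) + 26300) * (L * r) =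
      14.003 * (L ^ 2 * M) + 5.5 * (L ^ 2 * (r * y ^ 2)) + 26300 * (L * r) := by
    field_simp
    ring
  rw [e2] at hfin
  have h1 : r * y ^ 2 ≤ M := by
    refine le_trans ?_ hMy
    calc r * y ^ 2 ≤ y * y ^ 2 := by gcongr
      _ = y ^ 3 := by ring
  have h2 : L ^ 2 * (r * y ^ 2) ≤ L ^ 2 * M := by gcongr
  have h3 : 26300 * (L * r) ≤ L ^ 2 * M := by
    have hrL : r ≤ L := by nlinarith
    have hM2 : 26300 ≤ M := by
      refine le_trans ?_ hMy
      calc (26300 : ℝ) ≤ 1000 ^ 3 := by norm_num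
        _ ≤ y ^ 3 := by gcongr
    calc 26300 * (L * r) ≤ M * (L * L) := by gcongr
      _ = L ^ 2 * M := by ring
  have h4 : 0 < L ^ 2 * M := by positivity
  norm_num at hfin
  nlinarith

/-- Explicit Carlson zero-density estimate:
for `0.6 ≤ σ ≤ 2/3` and `T ≥ T₀ ≥ 3·10^12`,
`N(σ,T) ≤ K(σ,T₀) · T^{4σ(1−σ)} · (log T)^{5−2σ}`. -/
theorem carlson_zero_density (σ T T₀ : ℝ) (hσl : 0.6 ≤ σ) (hσu : σ ≤ 2/3)
    (hT₀ : 3 * 10^12 ≤ T₀) (hT : T₀ ≤ T) :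
    (Nzeros σ T : ℝ) ≤ Kconst σ T₀ * T ^ (4*σ*(1 - σ)) * Real.log T ^ (5 - 2*σ) := by
  have hT0 : 0 < T := by linarith
  have hL₀ := twenty_seven_le_log hT₀
  have hL := twenty_seven_le_log (hT₀.trans hT)
  have hLL : Real.log T₀ ≤ Real.log T := Real.log_le_log (by linarith) hT
  have hK := Kconst_ge (T₀ := T₀) hσl hσu (by linarith) (by linarith)
  refine (Nzeros_le hσl hσu (hT₀.trans hT)).trans ?_
  set L := Real.log T
  have hL0 : 0 < L := by linarith
  have hK' : 2.7 / L ≤ Kconst σ T₀ :=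
    (div_le_div_of_nonneg_left (by norm_num) (by linarith) hLL).trans hK
  have hpow : 9 * L ^ 3 ≤ L ^ (5 - 2 * σ) := by
    have e : L ^ (5 - 2 * σ) = L ^ (2 - 2 * σ) * L ^ 3 := by
      rw [← Real.rpow_natCast, ← Real.rpow_add hL0]
      congr 1
      push_cast
      ring
    rw [e]
    gcongr
    calc (9 : ℝ) = 27 ^ (2 / 3 : ℝ) := by
          rw [show (27 : ℝ) = 3 ^ (3 : ℝ) by norm_num, ← Real.rpow_mul (by norm_num)]
          norm_num
      _ ≤ 27 ^ (2 - 2 * σ) := Real.rpow_le_rpow_of_exponent_le (by norm_num) (by linarith)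
      _ ≤ L ^ (2 - 2 * σ) := Real.rpow_le_rpow (by norm_num) hL (by linarith)
  calc 10 * L ^ 2 * T ^ (4 * σ * (1 - σ)) ≤ 24.3 * L ^ 2 * T ^ (4 * σ * (1 - σ)) := by
        gcongr
        norm_num
    _ = 2.7 / L * T ^ (4 * σ * (1 - σ)) * (9 * L ^ 3) := by
        field_simp
        norm_num
    _ ≤ _ := by
        have : 0 ≤ Kconst σ T₀ := le_trans (by positivity) hK'
        gcongr
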